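/- Let I be a partial computable information content measure and let X be a binary stream such that I(X↾n) is defined for every n. Then there exists a Martin-Löf random binary stream Y such that X is computable from Y with oracle-use n ↦ min_{i≥n} I(X↾i). -/

import Mathlib

open scoped ENNReal

abbrev BStr := List Bool

/-- The first `n` bits of the stream `X`, as a binary string. -/
def stake (X : ℕ → Bool) (n : ℕ) : BStr := (List.range n).map X

/-- A set of binary strings is prefix-free if no element is a proper prefix of another. -/
def PrefixFreeSet (S : Set BStr) : Prop :=
  ∀ σ ∈ S, ∀ τ ∈ S, σ <+: τ → σ = τ

/-- `X` is computable from `Y` with oracle-use `f`. -/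
def ComputableWithUse (X Y : ℕ → Bool) (f : ℕ → ℕ) : Prop :=
  ∃ F : ℕ × BStr →. BStr, Partrec F ∧ ∀ n, stake X n ∈ F (n, stake Y (f n))

/-- A prefix-free machine: partial computable with prefix-free domain. -/
def PrefixFreeMachine (M : BStr →. BStr) : Prop :=
  Partrec M ∧ PrefixFreeSet {ρ | (M ρ).Dom}

/-- `K_M σ`: least length of an `M`-description of `σ` (`⊤` if none). -/
noncomputable def KM (M : BStr →. BStr) (σ : BStr) : ℕ∞ :=
  sInf ((fun ρ : BStr => (ρ.length : ℕ∞)) '' {ρ | σ ∈ M ρ})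

/-- Universal prefix-free machine. -/
def UniversalPFM (U : BStr →. BStr) : Prop :=
  PrefixFreeMachine U ∧
    ∀ M : BStr →. BStr, PrefixFreeMachine M →
      ∃ c : ℕ, ∀ σ, KM U σ ≤ KM M σ + (c : ℕ∞)

/-- Prefix-free Kolmogorov complexity w.r.t. `U`, as a natural number. -/
noncomputable def Kof (U : BStr →. BStr) (σ : BStr) : ℕ := (KM U σ).toNat

/-- Martin-Löf randomness via Schnorr's characterization: `K(Y↾n) ≥ n - c`. -/
def MLRandom (U : BStr →. BStr) (Y : ℕ → Bool) : Prop :=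
  ∃ c : ℕ, ∀ n, n ≤ Kof U (stake Y n) + c

/-- The weight `2^{-I(σ)}` contributed by `σ` (zero if `I σ` is undefined). -/
noncomputable def iweight (I : BStr →. ℕ) (σ : BStr) : ℝ≥0∞ :=
  haveI := Classical.propDecidable (I σ).Dom
  if h : (I σ).Dom then ((2 : ℝ≥0∞) ^ ((I σ).get h))⁻¹ else 0

/-! ### Overlap weights of cylinders -/

/-- The uniform measure of the intersection of the cylinders of `v` and `ρ`. -/
noncomputable def overlap (v ρ : BStr) : ℝ :=
  if v <+: ρ then (1 / 2) ^ ρ.length else if ρ <+: v then (1 / 2) ^ v.length else 0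

lemma overlap_nonneg (v ρ : BStr) : 0 ≤ overlap v ρ := by
  unfold overlap; split_ifs <;> positivity

lemma overlap_nil (ρ : BStr) : overlap [] ρ = (1 / 2) ^ ρ.length := by
  simp [overlap]

lemma overlap_of_prefix {v ρ : BStr} (h : v <+: ρ) : overlap v ρ = (1 / 2) ^ ρ.length := by
  simp [overlap, h]

lemma overlap_of_prefix_right {v ρ : BStr} (h : ρ <+: v) : overlap v ρ = (1 / 2) ^ v.length := by
  unfold overlap
  split_ifs with h'
  · rw [h.eq_of_length_le h'.length_le]
  · rfl

lemma overlap_of_not {v ρ : BStr} (h : ¬ v <+: ρ) (h' : ¬ ρ <+: v) : overlap v ρ = 0 := by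
  simp [overlap, h, h']

lemma overlap_split (v ρ : BStr) (c : Bool) :
    overlap v ρ = overlap v (ρ ++ [c]) + overlap v (ρ ++ [!c]) := by
  by_cases h : v <+: ρ
  · rw [overlap_of_prefix h, overlap_of_prefix (h.trans (List.prefix_append _ _)),
      overlap_of_prefix (h.trans (List.prefix_append _ _))]
    simp only [List.length_append, List.length_singleton, pow_succ]
    ring
  by_cases h' : ρ <+: v
  · obtain ⟨t, rfl⟩ := h'
    rw [overlap_of_prefix_right (List.prefix_append _ _)]
    match t with
    | [] => simp at h
    | d :: t =>
      have key : ∀ c : Bool, c ≠ d → overlap (ρ ++ d :: t) (ρ ++ [c]) = 0 := by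
        intro c hc
        apply overlap_of_not
        · rw [List.prefix_append_right_inj]
          simp [List.cons_prefix_cons, hc.symm]
        · rw [List.prefix_append_right_inj]
          simp [List.cons_prefix_cons, hc]
      have key2 : overlap (ρ ++ d :: t) (ρ ++ [d]) = (1 / 2) ^ (ρ ++ d :: t).length := by
        apply overlap_of_prefix_right
        rw [List.prefix_append_right_inj]
        simp [List.cons_prefix_cons]
      by_cases hc : c = d
      · subst hc
        rw [key2, key (!c) (by simp), add_zero]
      · have : (!c) = d := by cases c <;> cases d <;> simp_all
        rw [this, key2, key c hc, zero_add]
  · have key : ∀ c : Bool, overlap v (ρ ++ [c]) = 0 := by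
      intro c
      apply overlap_of_not
      · rw [List.prefix_concat_iff]
        rintro (rfl | h1)
        · exact h' (List.prefix_append _ _)
        · exact h h1
      · intro h1
        exact h' ((List.prefix_append _ _).trans h1)
    rw [overlap_of_not h h', key, key, add_zero]

/-! ### Selecting an optimal element of a list -/

/-- The first element of `l` that dominates all the others with respect to `le`. -/
def pick {α : Type*} (le : α → α → Bool) (l : List α) : Option α :=
  (l.filter fun a => l.all fun b => le b a).head?

lemma pick_spec {α : Type*} {le : α → α → Bool} {l : List α} {a : α} (h : pick le l = some a) :
    a ∈ l ∧ ∀ b ∈ l, le b a = true := by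
  have := List.mem_of_head? h
  simpa using this

lemma exists_pick {α κ : Type*} [LinearOrder κ] (f : α → κ) {le : α → α → Bool}
    (hle : ∀ a b, le a b = true ↔ f a ≤ f b) {l : List α} (hl : l ≠ []) :
    ∃ a, pick le l = some a := by
  classical
  obtain ⟨a, ha, hmax⟩ := l.toFinset.exists_max_image f (by
    obtain ⟨x, hx⟩ := List.exists_mem_of_ne_nil l hl
    exact ⟨x, by simpa using hx⟩)
  have : pick le l ≠ none := by
    unfold pick
    rw [Ne, List.head?_eq_none_iff, List.filter_eq_nil_iff]
    intro hc
    apply hc a (by simpa using ha)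
    simp only [List.all_eq_true]
    intro b hb
    exact (hle _ _).2 (hmax b (by simpa using hb))
  exact Option.ne_none_iff_exists'.1 this

/-! ### The allocation algorithm -/

/-- A block is a cylinder (first component) together with a label (second component). -/
abbrev Block := BStr × BStr

/-- The current labelled partition of Cantor space, and the log of all past labellings. -/
abbrev AllocState := List Block × List Block

/-- Some live block carries a label extending `σ`. -/
def isServed (live : BStr → Bool) (σ : BStr) (S : List Block) : Bool :=
  S.any fun b => live b.1 && decide (σ <+: b.2)

/-- A live block whose label is a proper prefix of `σ` and which is large enough to be given
any label between its present one and `σ`. -/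
def isUsable (live : BStr → Bool) (j : BStr → ℕ) (σ : BStr) (b : Block) : Bool :=
  live b.1 && (decide (b.2 <+: σ) && (decide (b.2.length < σ.length) &&
    (List.range σ.length).all fun i =>
      decide (i < b.2.length) || decide (b.1.length ≤ j (σ.take (i + 1)))))

/-- Lexicographic comparison of blocks by length of label, then by length of cylinder. -/
def blockLE (a b : Block) : Bool :=
  decide (a.2.length < b.2.length) ||
    (decide (a.2.length = b.2.length) && decide (a.1.length ≤ b.1.length))

/-- The usable block that is chosen to serve `σ`. -/
def chooseBlock (live : BStr → Bool) (j : BStr → ℕ) (σ : BStr) (S : List Block) : Option Block :=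
  pick blockLE (S.filter (isUsable live j σ))

/-- The index (minus one) of a prefix of `σ` longer than `t` with the smallest request. -/
def chooseIndex (j : BStr → ℕ) (σ : BStr) (t : ℕ) : Option ℕ :=
  pick (fun i i' => decide (j (σ.take (i' + 1)) ≤ j (σ.take (i + 1))))
    ((List.range σ.length).filter fun i => decide (t ≤ i))

/-- Halve the current cylinder, keeping a live half if there is one. -/
def halve (live : BStr → Bool) (τ : BStr) (x : BStr × List Block) : BStr × List Block :=
  (x.1 ++ [!live (x.1 ++ [false])], (x.1 ++ [live (x.1 ++ [false])], τ) :: x.2)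

/-- Cut a block of length `m` from `b` and give it the label `π`. -/
def reassign (live : BStr → Bool) (b : Block) (m : ℕ) (π : BStr) (x : AllocState) : AllocState :=
  let r := (halve live b.2)^[m - b.1.length] (b.1, x.1.filter fun a => !decide (a = b))
  ((r.1, π) :: r.2, (r.1, π) :: x.2)

/-- One step towards serving `σ`. -/
def serveStep (live : BStr → Bool) (j : BStr → ℕ) (σ : BStr) (x : AllocState) : AllocState :=
  if isServed live σ x.1 then x else
    match chooseBlock live j σ x.1 with
    | none => x
    | some b =>
      match chooseIndex j σ b.2.length with
      | none => x
      | some i => reassign live b (j (σ.take (i + 1))) (σ.take (i + 1)) x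

/-- Serve `σ`. -/
def serve (live : BStr → Bool) (j : BStr → ℕ) (σ : BStr) (x : AllocState) : AllocState :=
  (serveStep live j σ)^[σ.length] x

/-! ### Invariants of the allocation algorithm -/

/-- The label and cylinder length of each live block. -/
def liveKeys (live : BStr → Bool) (S : List Block) : List (BStr × ℕ) :=
  (S.filter fun b => live b.1).map fun b => (b.2, b.1.length)

lemma mem_liveKeys {live : BStr → Bool} {S : List Block} {k : BStr × ℕ} :
    k ∈ liveKeys live S ↔ ∃ b ∈ S, live b.1 = true ∧ (b.2, b.1.length) = k := by
  simp [liveKeys, and_assoc]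

/-- The sum over `S` of the overlaps with the cylinder of `v`. -/
noncomputable def totalOverlap (v : BStr) (S : List Block) : ℝ :=
  (S.map fun b => overlap v b.1).sum

@[simp] lemma totalOverlap_cons (v : BStr) (b : Block) (S : List Block) :
    totalOverlap v (b :: S) = overlap v b.1 + totalOverlap v S := by
  simp [totalOverlap]

lemma totalOverlap_nonneg (v : BStr) (S : List Block) : 0 ≤ totalOverlap v S := by
  apply List.sum_nonneg
  simp only [List.mem_map]
  rintro _ ⟨b, -, rfl⟩
  exact overlap_nonneg _ _

lemma overlap_le_totalOverlap {v : BStr} {b : Block} {S : List Block} (hb : b ∈ S) :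
    overlap v b.1 ≤ totalOverlap v S := by
  have h := (List.perm_cons_erase hb).map (fun b => overlap v b.1)
  have h2 := h.sum_eq
  have := totalOverlap_nonneg v (S.erase b)
  unfold totalOverlap at *
  rw [h2, List.map_cons, List.sum_cons]
  linarith

lemma halve_iterate {live : BStr → Bool} {τ ρ : BStr} {R : List Block} {m : ℕ}
    (hsplit : ∀ ρ, live ρ = true → live (ρ ++ [false]) = true ∨ live (ρ ++ [true]) = true)
    (hlive : live ρ = true) (hnodup : (liveKeys live R).Nodup)
    (hfree : ∀ k, ρ.length < k → k ≤ m → (τ, k) ∉ liveKeys live R)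
    (d : ℕ) (hd : ρ.length + d ≤ m) :
    let r := (halve live τ)^[d] (ρ, R)
    live r.1 = true ∧ ρ <+: r.1 ∧ r.1.length = ρ.length + d ∧
      (∀ v, overlap v r.1 + totalOverlap v r.2 = overlap v ρ + totalOverlap v R) ∧
      (liveKeys live r.2).Nodup ∧
      (∀ k, ρ.length + d < k → k ≤ m → (τ, k) ∉ liveKeys live r.2) ∧
      (∀ a ∈ R, a ∈ r.2) ∧
      (∀ a ∈ r.2, a ∈ R ∨ (ρ <+: a.1 ∧ ρ.length < a.1.length ∧ a.2 = τ)) := by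
  induction d with
  | zero => simpa [hlive, hnodup] using ⟨hfree, fun a b h => Or.inl h⟩
  | succ d ih =>
    obtain ⟨h1, h2, h3, h4, h5, h6, h7, h8⟩ := ih (by omega)
    simp only [Function.iterate_succ_apply']
    generalize (halve live τ)^[d] (ρ, R) = r at *
    obtain ⟨p, acc⟩ := r
    simp only [halve] at *
    refine ⟨?_, ?_, ?_, ?_, ?_, ?_, ?_, ?_⟩
    · cases h : live (p ++ [false])
      · simpa [h] using hsplit p h1
      · simpa using h
    · exact h2.trans (List.prefix_append _ _)
    · simp; omega
    · intro v
      rw [← h4, totalOverlap_cons, overlap_split v p (!live (p ++ [false])), Bool.not_not]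
      ring
    · unfold liveKeys at *
      rw [List.filter_cons]
      split_ifs
      · rw [List.map_cons, List.nodup_cons]
        refine ⟨?_, h5⟩
        have := h6 (ρ.length + d + 1) (by omega) (by omega)
        simpa [h3] using this
      · exact h5
    · intro k hk hkm hmem
      rw [mem_liveKeys] at hmem
      obtain ⟨b, hb, hlb, hbk⟩ := hmem
      rcases List.mem_cons.1 hb with rfl | hb
      · simp at hbk; omega
      · exact h6 k (by omega) hkm (mem_liveKeys.2 ⟨b, hb, hlb, hbk⟩)
    · intro a ha
      exact List.mem_cons_of_mem _ (h7 a ha)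
    · intro a ha
      rcases List.mem_cons.1 ha with rfl | ha
      · right
        refine ⟨h2.trans (List.prefix_append _ _), ?_, rfl⟩
        simp; omega
      · exact h8 a ha

/-- The invariant maintained by the allocation algorithm, for the requests `I` on the
strings in `D`. -/
structure AllocInv (live : BStr → Bool) (I : BStr → ℕ) (D : Set BStr) (x : AllocState) :
    Prop where
  part : ∀ v, totalOverlap v x.1 = (1 / 2) ^ v.length
  nodup : (liveKeys live x.1).Nodup
  len : ∀ b ∈ x.1, b.2 ≠ [] → b.2 ∈ D ∧ I b.2 ≤ b.1.length
  use : ∀ b ∈ x.1, ∀ i, 0 < i → i ≤ b.2.length →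
    ∃ e ∈ x.2, e.1 <+: b.1 ∧ e.1.length ≤ I (b.2.take i) ∧ b.2.take i <+: e.2
  sound : ∀ e ∈ x.2, ∀ b ∈ x.1, (e.1 <+: b.1 ∨ b.1 <+: e.1) → e.2 <+: b.2

lemma not_comparable_of_totalOverlap {S R : List Block} {b a : Block}
    (hpart : ∀ v, totalOverlap v S = (1 / 2) ^ v.length)
    (hS : ∀ v, totalOverlap v S = overlap v b.1 + totalOverlap v R) (ha : a ∈ R) :
    ¬ a.1 <+: b.1 ∧ ¬ b.1 <+: a.1 := by
  have key : ∀ v, b.1 <+: v → a.1 <+: v → False := by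
    intro v h1 h2
    have h3 := hpart v
    rw [hS, overlap_of_prefix_right h1] at h3
    have h4 := overlap_le_totalOverlap (v := v) ha
    rw [overlap_of_prefix_right h2] at h4
    have : (0 : ℝ) < (1 / 2) ^ v.length := by positivity
    linarith
  exact ⟨fun h => key b.1 (List.prefix_refl _) h, fun h => key a.1 h (List.prefix_refl _)⟩

lemma totalOverlap_perm {S R : List Block} (h : S.Perm R) (v : BStr) :
    totalOverlap v S = totalOverlap v R := (h.map _).sum_eq

lemma liveKeys_perm {live : BStr → Bool} {S R : List Block} (h : S.Perm R) :
    (liveKeys live S).Perm (liveKeys live R) := (h.filter _).map _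

lemma perm_cons_filter_ne {live : BStr → Bool} {S : List Block} (hS : (liveKeys live S).Nodup)
    {b : Block} (hb : b ∈ S) (hl : live b.1 = true) :
    S.Perm (b :: S.filter fun a => !decide (a = b)) := by
  have h1 : (S.filter fun b => live b.1).Nodup := List.Nodup.of_map _ hS
  have h2 : S.count b = 1 := by
    have h3 : (S.filter fun b => live b.1).count b = S.count b := List.count_filter hl
    rw [← h3]
    exact List.count_eq_one_of_mem h1 (List.mem_filter.2 ⟨hb, hl⟩)
  have h4 := List.filter_append_perm (fun a => decide (a = b)) S
  have h5 : S.filter (fun a => decide (a = b)) = [b] := by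
    have : S.filter (fun a => a == b) = List.replicate (S.count b) b := List.filter_beq b
    rw [h2] at this
    simpa [beq_eq_decide] using this
  rw [h5] at h4
  exact h4.symm

lemma AllocInv.reassign_spec {live : BStr → Bool} {I : BStr → ℕ} {D : Set BStr} {x : AllocState}
    (hx : AllocInv live I D x)
    (hsplit : ∀ ρ, live ρ = true → live (ρ ++ [false]) = true ∨ live (ρ ++ [true]) = true)
    {b : Block} (hb : b ∈ x.1) (hl : live b.1 = true) {m : ℕ} {π : BStr} (hπD : π ∈ D)
    (hπ : b.2 <+: π) (hlt : b.2.length < π.length) (hm : I π = m) (hbm : b.1.length ≤ m)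
    (hmin : ∀ i, b.2.length < i → i ≤ π.length → m ≤ I (π.take i))
    (hmax : ∀ k, b.1.length < k → k ≤ m → (b.2, k) ∉ liveKeys live x.1)
    (hnew : (π, m) ∉ liveKeys live x.1) :
    AllocInv live I D (reassign live b m π x) ∧
      (∃ p, (p, π) ∈ (reassign live b m π x).1 ∧ live p = true ∧ p.length = m) ∧
      (∀ a ∈ x.1, a = b ∨ a ∈ (reassign live b m π x).1) ∧
      x.2 ⊆ (reassign live b m π x).2 := by
  obtain ⟨S, L⟩ := x
  have hperm := perm_cons_filter_ne hx.nodup hb hl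
  simp only [reassign] at *
  set R := S.filter fun a => !decide (a = b) with hR
  have hRS : ∀ a ∈ R, a ∈ S := fun a ha => (List.mem_filter.1 ha).1
  have hnd : (liveKeys live R).Nodup := by
    have := (liveKeys_perm (live := live) hperm).nodup_iff.1 hx.nodup
    rw [liveKeys, List.filter_cons, if_pos hl, List.map_cons, List.nodup_cons] at this
    exact this.2
  have hsub : ∀ k, k ∈ liveKeys live R → k ∈ liveKeys live S := by
    intro k hk
    obtain ⟨a, ha, h⟩ := mem_liveKeys.1 hk
    exact mem_liveKeys.2 ⟨a, hRS a ha, h⟩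
  have htot : ∀ v, totalOverlap v S = overlap v b.1 + totalOverlap v R := by
    intro v; rw [totalOverlap_perm hperm, totalOverlap_cons]
  obtain ⟨h1, h2, h3, h4, h5, h6, h7, h8⟩ := halve_iterate hsplit hl hnd
    (fun k hk hkm h => hmax k hk hkm (hsub _ h)) (m - b.1.length) (by omega)
  generalize (halve live b.2)^[m - b.1.length] (b.1, R) = r at *
  obtain ⟨p, acc⟩ := r
  simp only at *
  have hpm : p.length = m := by omega
  have hpart : ∀ v, totalOverlap v ((p, π) :: acc) = (1 / 2) ^ v.length := by
    intro v
    rw [totalOverlap_cons, h4, ← htot, hx.part]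
  have hold : ∀ a ∈ acc, ∃ a' ∈ S, a'.1 <+: a.1 ∧ a'.2 = a.2 := by
    intro a ha
    rcases h8 a ha with h | ⟨h, -, h'⟩
    · exact ⟨a, hRS a h, List.prefix_refl _, rfl⟩
    · exact ⟨b, hb, h, h'.symm⟩
  have hne : b.2 ≠ π := by rintro h; rw [h] at hlt; omega
  refine ⟨⟨hpart, ?_, ?_, ?_, ?_⟩, ?_, ?_, ?_⟩
  · rw [liveKeys, List.filter_cons, if_pos h1, List.map_cons, List.nodup_cons]
    refine ⟨?_, h5⟩
    intro hmem
    obtain ⟨a, ha, hla, hak⟩ := mem_liveKeys.1 hmem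
    simp only [hpm, Prod.mk.injEq] at hak
    rcases h8 a ha with h | ⟨-, -, h⟩
    · exact hnew (mem_liveKeys.2 ⟨a, hRS a h, hla, by simp [hak]⟩)
    · exact hne (h.symm.trans hak.1)
  · intro a ha hane
    rcases List.mem_cons.1 ha with rfl | ha
    · exact ⟨hπD, by simp [hm, hpm]⟩
    · rcases h8 a ha with h | ⟨-, h, h'⟩
      · exact hx.len a (hRS a h) hane
      · rw [h'] at hane ⊢
        have := hx.len b hb hane
        exact ⟨this.1, this.2.trans h.le⟩
  · intro a ha i hi hil
    rcases List.mem_cons.1 ha with rfl | ha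
    · by_cases hib : i ≤ b.2.length
      · obtain ⟨e, he, he1, he2, he3⟩ := hx.use b hb i hi hib
        have : b.2.take i = π.take i := by
          obtain ⟨t, rfl⟩ := hπ
          rw [List.take_append_of_le_length hib]
        rw [this] at he2 he3
        exact ⟨e, List.mem_cons_of_mem _ he, he1.trans h2, he2, he3⟩
      · refine ⟨(p, π), List.mem_cons_self .., List.prefix_refl _, ?_, List.take_prefix _ _⟩
        simp only [hpm]
        exact hmin i (by omega) hil
    · obtain ⟨a', ha', hp', hl'⟩ := hold a ha
      rw [← hl'] at hil ⊢
      obtain ⟨e, he, he1, he2, he3⟩ := hx.use a' ha' i hi hil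
      exact ⟨e, List.mem_cons_of_mem _ he, he1.trans hp', he2, he3⟩
  · intro e he a ha hcomp
    have hcomp' : ∀ c d f : BStr, c <+: d → (f <+: d ∨ d <+: f) → (f <+: c ∨ c <+: f) := by
      intro c d f hcd h
      rcases h with h | h
      · exact List.prefix_or_prefix_of_prefix h hcd
      · exact Or.inr (hcd.trans h)
    rcases List.mem_cons.1 he with rfl | he
    · rcases List.mem_cons.1 ha with rfl | ha
      · exact List.prefix_refl _
      · have := not_comparable_of_totalOverlap hpart (b := (p, π)) (R := acc)
          (fun v => totalOverlap_cons _ _ _) ha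
        exact absurd hcomp (by tauto)
    · rcases List.mem_cons.1 ha with rfl | ha
      · exact (hx.sound e he b hb (hcomp' _ _ _ h2 hcomp)).trans hπ
      · obtain ⟨a', ha', hp', hl'⟩ := hold a ha
        rw [← hl']
        exact hx.sound e he a' ha' (hcomp' _ _ _ hp' hcomp)
  · exact ⟨p, List.mem_cons_self .., h1, hpm⟩
  · intro a ha
    by_cases hab : a = b
    · exact Or.inl hab
    · exact Or.inr (List.mem_cons_of_mem _ (h7 a (List.mem_filter.2 ⟨ha, by simpa using hab⟩)))
  · exact List.subset_cons_self _ _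

/-! ### The allocation never gets stuck -/

lemma sum_range_ite_half_pow (a N : ℕ) :
    (∑ n ∈ Finset.range N, if a ≤ n then (1 / 2 : ℝ) ^ n else 0) ≤ 2 * (1 / 2) ^ a := by
  have key : (∑ n ∈ Finset.range N, if a ≤ n then (1 / 2 : ℝ) ^ n else 0) +
      2 * (1 / 2) ^ (max a N) = 2 * (1 / 2) ^ a := by
    induction N with
    | zero => simp
    | succ N ih =>
      rw [Finset.sum_range_succ]
      by_cases h : a ≤ N
      · rw [max_eq_right h] at ih
        rw [if_pos h, max_eq_right (by omega : a ≤ N + 1), pow_succ, ← ih]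
        ring
      · rw [max_eq_left (by omega : N ≤ a)] at ih
        rw [if_neg h, max_eq_left (by omega : N + 1 ≤ a), add_zero, ih]
  have : (0 : ℝ) ≤ 2 * (1 / 2) ^ (max a N) := by positivity
  linarith

/-- `live` holds of the cylinders that are not exhausted by the strings of `V`, whose total
weight is small. -/
structure IsLiveness (live : BStr → Bool) (V : List BStr) : Prop where
  live_iff : ∀ ρ, live ρ = true ↔ (V.map fun v => overlap v ρ).sum < (1 / 2) ^ ρ.length
  weight : (V.map fun v : BStr => (1 / 2 : ℝ) ^ v.length).sum < 1 / 4

lemma sum_overlap_split (V : List BStr) (ρ : BStr) (c : Bool) :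
    (V.map fun v => overlap v ρ).sum =
      (V.map fun v => overlap v (ρ ++ [c])).sum + (V.map fun v => overlap v (ρ ++ [!c])).sum := by
  rw [← List.sum_map_add]
  simp_rw [← overlap_split]

lemma IsLiveness.split {live : BStr → Bool} {V : List BStr} (h : IsLiveness live V) (ρ : BStr)
    (hρ : live ρ = true) : live (ρ ++ [false]) = true ∨ live (ρ ++ [true]) = true := by
  rw [h.live_iff] at hρ ⊢
  rw [h.live_iff]
  by_contra! hc
  obtain ⟨h1, h2⟩ := hc
  have h3 := sum_overlap_split V ρ false
  simp only [Bool.not_false] at h3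
  simp only [List.length_append, List.length_singleton, pow_succ] at h1 h2
  linarith

lemma sum_sum_overlap (S : List Block) (V : List BStr) :
    (S.map fun b => (V.map fun v => overlap v b.1).sum).sum =
      (V.map fun v => totalOverlap v S).sum := by
  induction S with
  | nil => simp [totalOverlap]
  | cons b S ih => simp [List.sum_map_add, ih]

lemma sum_live_le {live : BStr → Bool} {S : List Block} (hS : (liveKeys live S).Nodup)
    (low : BStr → ℕ) (hlow : ∀ b ∈ S, live b.1 = true → low b.2 ≤ b.1.length) :
    (S.map fun b => if live b.1 then (1 / 2 : ℝ) ^ b.1.length else 0).sum ≤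
      ∑ τ ∈ (S.map Prod.snd).toFinset, 2 * (1 / 2) ^ low τ := by
  classical
  have h1 : (S.map fun b => if live b.1 then (1 / 2 : ℝ) ^ b.1.length else 0).sum =
      ((liveKeys live S).map fun k => (1 / 2 : ℝ) ^ k.2).sum := by
    clear hS hlow
    induction S with
    | nil => simp [liveKeys]
    | cons b S ih =>
      rw [List.map_cons, List.sum_cons, ih]
      unfold liveKeys
      rw [List.filter_cons]
      split_ifs <;> simp
  rw [h1, ← List.sum_toFinset _ hS]
  set K := (liveKeys live S).toFinset
  set T := (S.map Prod.snd).toFinset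
  set N := K.sup Prod.snd + 1
  have h2 : ∀ k ∈ K, k.1 ∈ T ∧ low k.1 ≤ k.2 ∧ k.2 < N := by
    intro k hk
    have hkN : k.2 ≤ K.sup Prod.snd := Finset.le_sup (f := Prod.snd) hk
    obtain ⟨b, hb, hl, rfl⟩ := mem_liveKeys.1 (List.mem_toFinset.1 hk)
    exact ⟨List.mem_toFinset.2 (List.mem_map_of_mem hb), hlow b hb hl, by omega⟩
  calc ∑ k ∈ K, (1 / 2 : ℝ) ^ k.2
      = ∑ k ∈ K, if low k.1 ≤ k.2 then (1 / 2 : ℝ) ^ k.2 else 0 :=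
        Finset.sum_congr rfl fun k hk => by rw [if_pos (h2 k hk).2.1]
    _ ≤ ∑ k ∈ T ×ˢ Finset.range N, if low k.1 ≤ k.2 then (1 / 2 : ℝ) ^ k.2 else 0 := by
        apply Finset.sum_le_sum_of_subset_of_nonneg
        · intro k hk
          simpa using ⟨(h2 k hk).1, (h2 k hk).2.2⟩
        · intros; positivity
    _ = ∑ τ ∈ T, ∑ n ∈ Finset.range N, if low τ ≤ n then (1 / 2 : ℝ) ^ n else 0 :=
        Finset.sum_product ..
    _ ≤ _ := Finset.sum_le_sum fun τ _ => sum_range_ite_half_pow _ _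

lemma exists_root_block {live : BStr → Bool} {V : List BStr} {I : BStr → ℕ} {D : Set BStr}
    {x : AllocState} (hx : AllocInv live I D x) (hV : IsLiveness live V)
    (hD : ∀ T : Finset BStr, ↑T ⊆ D → ∑ τ ∈ T, (1 / 2 : ℝ) ^ I τ ≤ 1 / 4)
    {σ : BStr} (hσ : σ ≠ []) (hσD : ∀ i, 0 < i → i ≤ σ.length → σ.take i ∈ D) :
    ∃ b ∈ x.1, live b.1 = true ∧ b.2 = [] ∧
      ∀ i, 0 < i → i ≤ σ.length → b.1.length ≤ I (σ.take i) := by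
  classical
  by_contra! hc
  have hlen : 0 < σ.length := List.length_pos_iff.2 hσ
  obtain ⟨i₀, hi₀, hmin⟩ := (Finset.Icc 1 σ.length).exists_min_image (fun i => I (σ.take i))
    ⟨1, by simp; omega⟩
  rw [Finset.mem_Icc] at hi₀
  set M := I (σ.take i₀)
  set low : BStr → ℕ := fun τ => if τ = [] then M + 1 else I τ with hlowdef
  have hlow : ∀ b ∈ x.1, live b.1 = true → low b.2 ≤ b.1.length := by
    intro b hb hl
    simp only [hlowdef]
    split_ifs with h
    · obtain ⟨i, hi, hil, hlt⟩ := hc b hb hl h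
      have := hmin i (Finset.mem_Icc.2 ⟨hi, hil⟩)
      omega
    · exact (hx.len b hb h).2
  have h1 := sum_live_le hx.nodup low hlow
  set T := (x.1.map Prod.snd).toFinset
  have h2 : ∑ τ ∈ T.erase [], (1 / 2 : ℝ) ^ I τ ≤ 1 / 4 := by
    apply hD
    intro τ hτ
    simp only [Finset.coe_erase, Set.mem_sdiff, Finset.mem_coe, Set.mem_singleton_iff] at hτ
    obtain ⟨b, hb, rfl⟩ := List.mem_map.1 (List.mem_toFinset.1 hτ.1)
    exact (hx.len b hb hτ.2).1
  have h3 : (1 / 2 : ℝ) ^ M ≤ 1 / 4 := by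
    simpa using hD {σ.take i₀} (by simpa using hσD i₀ hi₀.1 hi₀.2)
  have h4 : ∑ τ ∈ T, 2 * (1 / 2 : ℝ) ^ low τ ≤ 3 / 4 := by
    calc ∑ τ ∈ T, 2 * (1 / 2 : ℝ) ^ low τ
        ≤ ∑ τ ∈ insert [] (T.erase []), 2 * (1 / 2 : ℝ) ^ low τ :=
          Finset.sum_le_sum_of_subset_of_nonneg (Finset.subset_insert_iff.2 subset_rfl)
            (fun _ _ _ => by positivity)
      _ = 2 * (1 / 2 : ℝ) ^ low [] + ∑ τ ∈ T.erase [], 2 * (1 / 2 : ℝ) ^ low τ :=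
          Finset.sum_insert (by simp)
      _ = (1 / 2 : ℝ) ^ M + 2 * ∑ τ ∈ T.erase [], (1 / 2 : ℝ) ^ I τ := by
          rw [Finset.mul_sum]
          congr 1
          · simp only [hlowdef, if_true, pow_succ]; ring
          · refine Finset.sum_congr rfl fun τ hτ => ?_
            simp only [hlowdef, if_neg (Finset.ne_of_mem_erase hτ)]
      _ ≤ 3 / 4 := by linarith
  have h5 : totalOverlap [] x.1 ≤
      (x.1.map fun b => (if live b.1 then (1 / 2 : ℝ) ^ b.1.length else 0) +
        (V.map fun v => overlap v b.1).sum).sum := by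
    apply List.sum_le_sum
    intro b _
    rw [overlap_nil]
    split_ifs with h
    · have : 0 ≤ (V.map fun v => overlap v b.1).sum := by
        apply List.sum_nonneg
        simp only [List.mem_map]
        rintro _ ⟨v, -, rfl⟩
        exact overlap_nonneg _ _
      linarith
    · rw [hV.live_iff, not_lt] at h
      linarith
  rw [List.sum_map_add, sum_sum_overlap] at h5
  simp_rw [hx.part] at h5
  have h6 := hV.weight
  simp only [List.length_nil, pow_zero] at h5
  linarith

lemma isUsable_iff {live : BStr → Bool} {j : BStr → ℕ} {σ : BStr} {b : Block} :
    isUsable live j σ b = true ↔ live b.1 = true ∧ b.2 <+: σ ∧ b.2.length < σ.length ∧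
      ∀ i, b.2.length < i → i ≤ σ.length → b.1.length ≤ j (σ.take i) := by
  simp only [isUsable, Bool.and_eq_true, decide_eq_true_eq, List.all_eq_true, List.mem_range,
    Bool.or_eq_true]
  refine and_congr_right fun _ => and_congr_right fun _ => and_congr_right fun _ => ?_
  constructor
  · intro h i hi hil
    have := h (i - 1) (by omega)
    rw [Nat.sub_add_cancel (by omega)] at this
    rcases this with h | h
    · omega
    · exact h
  · intro h i hi
    by_cases hb : i < b.2.length
    · exact Or.inl hb
    · exact Or.inr (h (i + 1) (by omega) (by omega))

lemma blockLE_iff (a b : Block) : blockLE a b = true ↔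
    toLex (a.2.length, a.1.length) ≤ toLex (b.2.length, b.1.length) := by
  simp [blockLE, Prod.Lex.toLex_le_toLex]

lemma isServed_iff {live : BStr → Bool} {σ : BStr} {S : List Block} :
    isServed live σ S = true ↔ ∃ b ∈ S, live b.1 = true ∧ σ <+: b.2 := by
  simp [isServed]

lemma serveStep_spec {live : BStr → Bool} {V : List BStr} {I j : BStr → ℕ} {D : Set BStr}
    {x : AllocState} (hx : AllocInv live I D x) (hV : IsLiveness live V) {σ : BStr}
    (hσD : ∀ i, 0 < i → i ≤ σ.length → σ.take i ∈ D)
    (hj : ∀ i, 0 < i → i ≤ σ.length → j (σ.take i) = I (σ.take i)) :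
    AllocInv live I D (serveStep live j σ x) ∧
      (∀ τ, isServed live τ x.1 = true → isServed live τ (serveStep live j σ x).1 = true) ∧
      x.2 ⊆ (serveStep live j σ x).2 ∧
      ∀ t, (isServed live σ x.1 = true ∨ ∃ b ∈ x.1, isUsable live j σ b = true ∧ t ≤ b.2.length) →
        (isServed live σ (serveStep live j σ x).1 = true ∨
          ∃ b ∈ (serveStep live j σ x).1, isUsable live j σ b = true ∧ t + 1 ≤ b.2.length) := by
  unfold serveStep
  by_cases hserved : isServed live σ x.1 = true
  · rw [if_pos hserved]
    exact ⟨hx, fun _ h => h, List.Subset.refl _, fun _ _ => Or.inl hserved⟩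
  rw [if_neg hserved]
  by_cases hne : x.1.filter (isUsable live j σ) = []
  · have : chooseBlock live j σ x.1 = none := by simp [chooseBlock, hne, pick]
    rw [this]
    refine ⟨hx, fun _ h => h, List.Subset.refl _, ?_⟩
    rintro t (h | ⟨b, hb, hu, -⟩)
    · exact absurd h hserved
    · rw [List.filter_eq_nil_iff] at hne
      exact absurd hu (hne b hb)
  obtain ⟨b, hbdef⟩ : ∃ b, chooseBlock live j σ x.1 = some b := exists_pick _ blockLE_iff hne
  simp only [hbdef]
  obtain ⟨hbmem, hbmax⟩ := pick_spec hbdef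
  rw [List.mem_filter] at hbmem
  obtain ⟨hb, hbu⟩ := hbmem
  obtain ⟨hbl, hbσ, hblt, hbj⟩ := isUsable_iff.1 hbu
  have hbmax' : ∀ a ∈ x.1, isUsable live j σ a = true → a.2.length < b.2.length ∨
      (a.2.length = b.2.length ∧ a.1.length ≤ b.1.length) := by
    intro a ha hu
    have := hbmax a (List.mem_filter.2 ⟨ha, hu⟩)
    simpa [blockLE] using this
  obtain ⟨i, hidef⟩ : ∃ i, chooseIndex j σ b.2.length = some i := by
    unfold chooseIndex
    apply exists_pick (κ := ℕᵒᵈ) (fun i => OrderDual.toDual (j (σ.take (i + 1))))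
    · intro a b; simp
    · apply List.ne_nil_of_mem (a := b.2.length)
      simpa using hblt
  simp only [hidef]
  obtain ⟨himem, himin⟩ := pick_spec hidef
  have hi : i < σ.length ∧ b.2.length ≤ i := by simpa using himem
  have himin' : ∀ k, b.2.length < k → k ≤ σ.length → j (σ.take (i + 1)) ≤ j (σ.take k) := by
    intro k hk hkl
    have := himin (k - 1) (by simp; omega)
    simpa [Nat.sub_add_cancel (by omega : 1 ≤ k)] using this
  have hlenπ : (σ.take (i + 1)).length = i + 1 := by simp; omega
  have hpre : b.2 <+: σ.take (i + 1) := by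
    rw [List.prefix_take_iff]; exact ⟨hbσ, by omega⟩
  obtain ⟨hinv, ⟨p, hp, hpl, hplen⟩, hkeep, hlog⟩ := hx.reassign_spec hV.split hb hbl
    (hσD (i + 1) (by omega) (by omega)) hpre (by omega) (hj _ (by omega) (by omega)).symm
    (hbj _ (by omega) (by omega))
    (by
      intro k hk hkl
      rw [List.take_take, min_eq_left (by omega), ← hj k (by omega) (by omega)]
      exact himin' k hk (by omega))
    (by
      intro k hk hkm hmem
      obtain ⟨a, ha, hal, hak⟩ := mem_liveKeys.1 hmem
      simp only [Prod.mk.injEq] at hak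
      obtain ⟨ha2, rfl⟩ := hak
      have := hbmax' a ha (isUsable_iff.2 ⟨hal, by rw [ha2]; exact hbσ, by rw [ha2]; exact hblt, by
        intro k hk hkl
        rw [ha2] at hk
        exact hkm.trans (himin' k hk hkl)⟩)
      rw [ha2] at this
      omega)
    (by
      intro hmem
      obtain ⟨a, ha, hal, hak⟩ := mem_liveKeys.1 hmem
      simp only [Prod.mk.injEq] at hak
      obtain ⟨ha2, halen⟩ := hak
      by_cases hil : i + 1 = σ.length
      · apply hserved
        rw [isServed_iff]
        refine ⟨a, ha, hal, ?_⟩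
        rw [ha2, hil, List.take_length]
      · have := hbmax' a ha (isUsable_iff.2 ⟨hal, by rw [ha2]; exact List.take_prefix _ _,
          by rw [ha2]; omega, by
            intro k hk hkl
            rw [ha2] at hk
            rw [halen]
            exact himin' k (by omega) hkl⟩)
        rw [ha2] at this
        omega)
  refine ⟨hinv, ?_, hlog, ?_⟩
  · intro τ hτ
    rw [isServed_iff] at hτ ⊢
    obtain ⟨a, ha, hal, haτ⟩ := hτ
    rcases hkeep a ha with rfl | h
    · exact ⟨_, hp, hpl, haτ.trans hpre⟩
    · exact ⟨a, h, hal, haτ⟩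
  · rintro t (h | ⟨a, ha, hu, hta⟩)
    · exact absurd h hserved
    have htb := hbmax' a ha hu
    by_cases hil : i + 1 = σ.length
    · left
      rw [isServed_iff]
      refine ⟨_, hp, hpl, ?_⟩
      simp only [hil, List.take_length]
      exact List.prefix_refl _
    · right
      refine ⟨_, hp, isUsable_iff.2 ⟨hpl, List.take_prefix _ _, by simp only [hlenπ]; omega, ?_⟩,
        by simp only [hlenπ]; omega⟩
      intro k hk hkl
      simp only [hlenπ] at hk
      simp only [hplen]
      exact himin' k (by omega) hkl

lemma serve_spec {live : BStr → Bool} {V : List BStr} {I j : BStr → ℕ} {D : Set BStr}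
    {x : AllocState} (hx : AllocInv live I D x) (hV : IsLiveness live V)
    (hD : ∀ T : Finset BStr, ↑T ⊆ D → ∑ τ ∈ T, (1 / 2 : ℝ) ^ I τ ≤ 1 / 4)
    {σ : BStr} (hσ : σ ≠ []) (hσD : ∀ i, 0 < i → i ≤ σ.length → σ.take i ∈ D)
    (hj : ∀ i, 0 < i → i ≤ σ.length → j (σ.take i) = I (σ.take i)) :
    AllocInv live I D (serve live j σ x) ∧
      (∀ τ, isServed live τ x.1 = true → isServed live τ (serve live j σ x).1 = true) ∧
      x.2 ⊆ (serve live j σ x).2 ∧ isServed live σ (serve live j σ x).1 = true := by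
  have key : ∀ t, AllocInv live I D ((serveStep live j σ)^[t] x) ∧
      (∀ τ, isServed live τ x.1 = true →
        isServed live τ ((serveStep live j σ)^[t] x).1 = true) ∧
      x.2 ⊆ ((serveStep live j σ)^[t] x).2 ∧
      (isServed live σ ((serveStep live j σ)^[t] x).1 = true ∨
        ∃ b ∈ ((serveStep live j σ)^[t] x).1, isUsable live j σ b = true ∧ t ≤ b.2.length) := by
    intro t
    induction t with
    | zero =>
      refine ⟨hx, fun _ h => h, List.Subset.refl _, Or.inr ?_⟩
      obtain ⟨b, hb, hl, hb2, hle⟩ := exists_root_block hx hV hD hσ hσD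
      refine ⟨b, hb, isUsable_iff.2 ⟨hl, by simp [hb2],
        by simpa [hb2] using List.length_pos_iff.2 hσ, ?_⟩, Nat.zero_le _⟩
      intro i hi hil
      rw [hj i (by omega) hil]
      exact hle i (by omega) hil
    | succ t ih =>
      obtain ⟨h1, h2, h3, h4⟩ := ih
      rw [Function.iterate_succ_apply']
      obtain ⟨g1, g2, g3, g4⟩ := serveStep_spec h1 hV hσD hj
      exact ⟨g1, fun τ h => g2 τ (h2 τ h), List.Subset.trans h3 g3, g4 t h4⟩
  obtain ⟨h1, h2, h3, h4⟩ := key σ.length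
  refine ⟨h1, h2, h3, ?_⟩
  rcases h4 with h | ⟨b, -, hu, hle⟩
  · exact h
  · have := (isUsable_iff.1 hu).2.2.1
    omega

/-! ### The allocation process and its limit streams -/

lemma length_stake (Y : ℕ → Bool) (n : ℕ) : (stake Y n).length = n := by simp [stake]

lemma getElem?_stake (Y : ℕ → Bool) (n i : ℕ) :
    (stake Y n)[i]? = if i < n then some (Y i) else none := by
  unfold stake
  split_ifs with h
  · simp [h]
  · simp; omega

lemma take_stake (Y : ℕ → Bool) {m n : ℕ} (h : m ≤ n) : (stake Y n).take m = stake Y m := by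
  rw [stake, ← List.map_take, List.take_range, min_eq_left h, stake]

lemma stake_prefix (Y : ℕ → Bool) {m n : ℕ} (h : m ≤ n) : stake Y m <+: stake Y n := by
  rw [← take_stake Y h]; exact List.take_prefix _ _

lemma eq_stake_of_prefix {Y : ℕ → Bool} {n : ℕ} {v : BStr} (h : v <+: stake Y n) :
    v = stake Y v.length := by
  have hl := h.length_le
  rw [length_stake] at hl
  rw [List.prefix_iff_eq_take, take_stake Y hl] at h
  exact h

lemma stake_congr {Y Z : ℕ → Bool} {n : ℕ} (h : ∀ i < n, Y i = Z i) : stake Y n = stake Z n := by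
  apply List.map_congr_left
  simpa using h

lemma IsLiveness.not_prefix {live : BStr → Bool} {V : List BStr} (h : IsLiveness live V)
    {ρ v : BStr} (hρ : live ρ = true) (hv : v ∈ V) : ¬ v <+: ρ := by
  intro hp
  rw [h.live_iff] at hρ
  have := List.single_le_sum (l := V.map fun v => overlap v ρ) (by
    simp only [List.mem_map]
    rintro _ ⟨v, -, rfl⟩
    exact overlap_nonneg _ _) _ (List.mem_map_of_mem hv)
  rw [overlap_of_prefix hp] at this
  linarith

lemma IsLiveness.exists_stream {live : BStr → Bool} {V : List BStr} (h : IsLiveness live V)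
    {ρ : BStr} (hρ : live ρ = true) :
    ∃ Y : ℕ → Bool, stake Y ρ.length = ρ ∧ ∀ k, stake Y k ∉ V := by
  set g : ℕ → BStr := fun k => (fun ρ => ρ ++ [!live (ρ ++ [false])])^[k] ρ with hg
  have hsucc : ∀ k, g (k + 1) = g k ++ [!live (g k ++ [false])] := fun k => by
    simp only [hg, Function.iterate_succ_apply']
  have hlive : ∀ k, live (g k) = true := by
    intro k
    induction k with
    | zero => exact hρ
    | succ k ih =>
      rw [hsucc]
      cases hk : live (g k ++ [false])
      · simpa [hk] using h.split _ ih
      · simpa using hk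
  have hlen : ∀ k, (g k).length = ρ.length + k := by
    intro k
    induction k with
    | zero => rfl
    | succ k ih => rw [hsucc, List.length_append, ih]; rfl
  have hmono : ∀ k d, g k <+: g (k + d) := by
    intro k d
    induction d with
    | zero => exact List.prefix_refl _
    | succ d ih => rw [← add_assoc, hsucc]; exact ih.trans (List.prefix_append _ _)
  have hstake : ∀ k, stake (fun i => (g (i + 1)).getD i false) (ρ.length + k) = g k := by
    intro k
    apply List.ext_getElem
    · rw [length_stake, hlen]
    · intro i h1 h2
      rw [length_stake] at h1
      simp only [stake, List.getElem_map, List.getElem_range]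
      have h3 : i < (g (i + 1)).length := by rw [hlen]; omega
      rw [List.getD_eq_getElem _ _ h3]
      rcases le_total k (i + 1) with hk | hk
      · obtain ⟨d, hd⟩ := Nat.exists_eq_add_of_le hk
        have := hmono k d
        rw [← hd] at this
        exact (this.getElem h2).symm
      · obtain ⟨d, rfl⟩ := Nat.exists_eq_add_of_le hk
        exact (hmono (i + 1) d).getElem h3
  refine ⟨fun i => (g (i + 1)).getD i false, hstake 0, fun k hk => ?_⟩
  exact h.not_prefix (hlive k) hk (by rw [← hstake k]; exact stake_prefix _ (by omega))

/-- The allocation process: at stage `s` all strings in `E s` are served. -/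
def allocState (live : ℕ → BStr → Bool) (J : ℕ → BStr → ℕ) (E : ℕ → List BStr) :
    ℕ → AllocState
  | 0 => ([([], [])], [([], [])])
  | s + 1 => (E s).foldl (fun x σ => serve (live s) (J s) σ x) (allocState live J E s)

/-- The hypotheses under which the allocation process succeeds. -/
structure AllocData (live : ℕ → BStr → Bool) (J : ℕ → BStr → ℕ) (E V : ℕ → List BStr)
    (I : BStr → ℕ) (D : Set BStr) : Prop where
  liveness : ∀ s, IsLiveness (live s) (V s)
  sublist : ∀ s, (V s).Sublist (V (s + 1))
  sum_le : ∀ T : Finset BStr, ↑T ⊆ D → ∑ τ ∈ T, (1 / 2 : ℝ) ^ I τ ≤ 1 / 4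
  ne_nil : ∀ s, ∀ σ ∈ E s, σ ≠ []
  mem_domain : ∀ s, ∀ σ ∈ E s, ∀ i, 0 < i → i ≤ σ.length → σ.take i ∈ D
  eq_request : ∀ s, ∀ σ ∈ E s, ∀ i, 0 < i → i ≤ σ.length → J s (σ.take i) = I (σ.take i)

lemma foldl_serve_spec {live : BStr → Bool} {V : List BStr} {I j : BStr → ℕ} {D : Set BStr}
    (hV : IsLiveness live V)
    (hD : ∀ T : Finset BStr, ↑T ⊆ D → ∑ τ ∈ T, (1 / 2 : ℝ) ^ I τ ≤ 1 / 4) (E : List BStr)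
    (hE : ∀ σ ∈ E, σ ≠ [] ∧ ∀ i, 0 < i → i ≤ σ.length →
      σ.take i ∈ D ∧ j (σ.take i) = I (σ.take i))
    {x : AllocState} (hx : AllocInv live I D x) :
    let y := E.foldl (fun x σ => serve live j σ x) x
    AllocInv live I D y ∧ x.2 ⊆ y.2 ∧
      (∀ τ, isServed live τ x.1 = true → isServed live τ y.1 = true) ∧
      ∀ σ ∈ E, isServed live σ y.1 = true := by
  induction E generalizing x with
  | nil => exact ⟨hx, List.Subset.refl _, fun _ h => h, by simp⟩
  | cons σ E ih =>
    obtain ⟨h1, h2⟩ := hE σ (List.mem_cons_self ..)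
    obtain ⟨g1, g2, g3, g4⟩ := serve_spec hx hV hD h1 (fun i hi hil => (h2 i hi hil).1)
      (fun i hi hil => (h2 i hi hil).2)
    obtain ⟨k1, k2, k3, k4⟩ := ih (fun τ hτ => hE τ (List.mem_cons_of_mem _ hτ)) g1
    refine ⟨k1, List.Subset.trans g3 k2, fun τ h => k3 τ (g2 τ h), ?_⟩
    intro τ hτ
    rcases List.mem_cons.1 hτ with rfl | hτ
    · exact k3 _ g4
    · exact k4 τ hτ

lemma IsLiveness.anti {live live' : BStr → Bool} {V V' : List BStr} (h : IsLiveness live V)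
    (h' : IsLiveness live' V') (hs : V.Sublist V') {ρ : BStr} (hρ : live' ρ = true) :
    live ρ = true := by
  rw [h.live_iff]
  rw [h'.live_iff] at hρ
  refine lt_of_le_of_lt ?_ hρ
  apply (hs.map _).sum_le_sum
  simp only [List.mem_map]
  rintro _ ⟨v, -, rfl⟩
  exact overlap_nonneg _ _

lemma AllocInv.anti {live live' : BStr → Bool} {I : BStr → ℕ} {D : Set BStr} {x : AllocState}
    (hx : AllocInv live I D x) (h : ∀ ρ, live' ρ = true → live ρ = true) :
    AllocInv live' I D x := by
  refine ⟨hx.part, ?_, hx.len, hx.use, hx.sound⟩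
  refine hx.nodup.sublist ?_
  unfold liveKeys
  exact (List.monotone_filter_right x.1 (p := fun b => live' b.1) (q := fun b => live b.1)
    fun b => h b.1).map _

namespace AllocData

variable {live : ℕ → BStr → Bool} {J : ℕ → BStr → ℕ} {E V : ℕ → List BStr}
  {I : BStr → ℕ} {D : Set BStr}

lemma step (h : AllocData live J E V I D) (s : ℕ)
    (hx : AllocInv (live s) I D (allocState live J E s)) :
    AllocInv (live s) I D (allocState live J E (s + 1)) ∧
      (allocState live J E s).2 ⊆ (allocState live J E (s + 1)).2 ∧
      ∀ σ ∈ E s, isServed (live s) σ (allocState live J E (s + 1)).1 = true := by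
  obtain ⟨h1, h2, -, h4⟩ := foldl_serve_spec (j := J s) (h.liveness s) h.sum_le (E s)
    (fun σ hσ => ⟨h.ne_nil s σ hσ, fun i hi hil =>
      ⟨h.mem_domain s σ hσ i hi hil, h.eq_request s σ hσ i hi hil⟩⟩) hx
  exact ⟨h1, h2, h4⟩

lemma inv (h : AllocData live J E V I D) (s : ℕ) :
    AllocInv (live s) I D (allocState live J E s) := by
  induction s with
  | zero =>
    refine ⟨fun v => ?_, ?_, ?_, ?_, ?_⟩
    · simp [allocState, totalOverlap, overlap_of_prefix_right]
    · simp only [allocState, liveKeys, List.filter_cons, List.filter_nil]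
      split_ifs <;> simp
    · simp [allocState]
    · simp [allocState]
    · simp [allocState]
  | succ s ih =>
    exact (h.step s ih).1.anti fun ρ => (h.liveness s).anti (h.liveness _) (h.sublist s)

lemma log_mono (h : AllocData live J E V I D) {s t : ℕ} (hst : s ≤ t) :
    (allocState live J E s).2 ⊆ (allocState live J E t).2 := by
  induction t, hst using Nat.le_induction with
  | base => exact List.Subset.refl _
  | succ t _ ih => exact List.Subset.trans ih (h.step t (h.inv t)).2.1

lemma mono (h : AllocData live J E V I D) {s t : ℕ} (hst : s ≤ t) : V s ⊆ V t := by
  induction t, hst using Nat.le_induction with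
  | base => exact List.Subset.refl _
  | succ t _ ih => exact List.Subset.trans ih (h.sublist t).subset

/-- Log entries on a common path have comparable labels. -/
lemma log_comparable (h : AllocData live J E V I D) {s t : ℕ} {e e' : Block}
    (he : e ∈ (allocState live J E s).2) (he' : e' ∈ (allocState live J E t).2) {ρ : BStr}
    (hρ : e.1 <+: ρ) (hρ' : e'.1 <+: ρ) : e.2 <+: e'.2 ∨ e'.2 <+: e.2 := by
  set u := max s t
  have h1 := h.log_mono (le_max_left s t) he
  have h2 := h.log_mono (le_max_right s t) he'
  have hinv := h.inv u
  obtain ⟨b, hb, hov⟩ : ∃ b ∈ (allocState live J E u).1, overlap ρ b.1 ≠ 0 := by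
    by_contra! hc
    have h3 := hinv.part ρ
    have h4 : totalOverlap ρ (allocState live J E u).1 = 0 := by
      apply List.sum_eq_zero
      intro y hy
      obtain ⟨b, hb, rfl⟩ := List.mem_map.1 hy
      exact hc b hb
    rw [h4] at h3
    have : (0 : ℝ) < (1 / 2) ^ ρ.length := by positivity
    linarith
  have hcomp : ρ <+: b.1 ∨ b.1 <+: ρ := by
    by_contra! hc
    exact hov (overlap_of_not hc.1 hc.2)
  have key : ∀ c : Block, c ∈ (allocState live J E u).2 → c.1 <+: ρ → c.2 <+: b.2 := by
    intro c hc hcρ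
    refine hinv.sound c hc b hb ?_
    rcases hcomp with h5 | h5
    · exact Or.inl (hcρ.trans h5)
    · exact List.prefix_or_prefix_of_prefix hcρ h5
  exact List.prefix_or_prefix_of_prefix (key e h1 hρ) (key e' h2 hρ')

lemma exists_stream_stage (h : AllocData live J E V I D) {σ : BStr} {s : ℕ} (hσ : σ ∈ E s) :
    ∃ Y : ℕ → Bool, (∀ k, stake Y k ∉ V s) ∧ ∀ i, 0 < i → i ≤ σ.length →
      ∃ e ∈ (allocState live J E (s + 1)).2,
        e.1 <+: stake Y (I (σ.take i)) ∧ σ.take i <+: e.2 := by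
  obtain ⟨h1, -, h3⟩ := h.step s (h.inv s)
  obtain ⟨b, hb, hbl, hbσ⟩ := isServed_iff.1 (h3 σ hσ)
  obtain ⟨Y, hY, hYV⟩ := (h.liveness s).exists_stream hbl
  refine ⟨Y, hYV, fun i hi hil => ?_⟩
  obtain ⟨e, he, he1, he2, he3⟩ := h1.use b hb i hi (hil.trans hbσ.length_le)
  have : b.2.take i = σ.take i := by
    obtain ⟨t, ht⟩ := hbσ
    rw [← ht, List.take_append_of_le_length hil]
  rw [this] at he2 he3
  rw [← hY] at he1
  exact ⟨e, he, by rw [eq_stake_of_prefix he1]; exact stake_prefix Y he2, he3⟩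

/-- A stream avoiding all the sets `V s` which codes `X` with the requested use. -/
lemma exists_stream (h : AllocData live J E V I D) {X : ℕ → Bool}
    (hX : ∀ n, 0 < n → ∃ s₀, ∀ s, s₀ ≤ s → stake X n ∈ E s) :
    ∃ Y : ℕ → Bool, (∀ s k, stake Y k ∉ V s) ∧ ∀ n, 0 < n → ∃ s, ∃ e ∈ (allocState live J E s).2,
      e.1 <+: stake Y (I (stake X n)) ∧ stake X n <+: e.2 := by
  have h1 : ∀ n : ℕ, ∃ s, n ≤ s ∧ stake X (n + 1) ∈ E s := by
    intro n
    obtain ⟨s₀, hs⟩ := hX (n + 1) (by omega)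
    exact ⟨max n s₀, le_max_left _ _, hs _ (le_max_right _ _)⟩
  choose S hS hSE using h1
  choose Z hZV hZ using fun n => h.exists_stream_stage (hSE n)
  obtain ⟨Y, φ, hφ, hlim⟩ := CompactSpace.tendsto_subseq Z
  have hagree : ∀ N, ∃ k₀, ∀ k, k₀ ≤ k → stake (Z (φ k)) N = stake Y N := by
    intro N
    have h2 : ∀ i, ∀ᶠ k in Filter.atTop, Z (φ k) i = Y i := by
      intro i
      have := (tendsto_pi_nhds.1 hlim) i
      rw [nhds_discrete, Filter.tendsto_pure] at this
      exact this
    have h3 : ∀ᶠ k in Filter.atTop, ∀ i ∈ Finset.range N, Z (φ k) i = Y i :=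
      (Filter.eventually_all_finset _).2 fun i _ => h2 i
    obtain ⟨k₀, hk⟩ := Filter.eventually_atTop.1 h3
    exact ⟨k₀, fun k hkk => stake_congr fun i hi => hk k hkk i (Finset.mem_range.2 hi)⟩
  refine ⟨Y, fun s N hmem => ?_, fun n hn => ?_⟩
  · obtain ⟨k₀, hk⟩ := hagree N
    have h4 := hk (max k₀ s) (le_max_left _ _)
    apply hZV (φ (max k₀ s)) N
    rw [h4]
    exact h.mono ((le_max_right k₀ s).trans ((hφ.id_le _).trans (hS _))) hmem
  · obtain ⟨k₀, hk⟩ := hagree (I (stake X n))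
    have h4 := hk (max k₀ n) (le_max_left _ _)
    have h5 : n ≤ φ (max k₀ n) := (le_max_right k₀ n).trans (hφ.id_le _)
    obtain ⟨e, he, he1, he2⟩ := hZ (φ (max k₀ n)) n hn (by rw [length_stake]; omega)
    rw [take_stake X (by omega)] at he1 he2
    rw [h4] at he1
    exact ⟨_, e, he, he1, he2⟩

end AllocData

/-! ### Primitive recursiveness of the allocation algorithm -/

section PrimrecAlloc

variable {α β : Type*} [Primcodable α] [Primcodable β]

lemma primrec_list_all {f : α → List β} {p : α → β → Bool} (hf : Primrec f) (hp : Primrec₂ p) :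
    Primrec fun a => (f a).all (p a) := by
  have key : ∀ (q : β → Bool) (l : List β) (b : Bool),
      l.foldl (fun acc x => acc && q x) b = (b && l.all q) := by
    intro q l
    induction l with
    | nil => simp
    | cons x l ih => intro b; simp [ih, Bool.and_assoc]
  refine (Primrec.list_foldl hf (Primrec.const true)
    (h := fun a x => x.1 && p a x.2) ?_).of_eq fun a => by simp [key]
  exact Primrec.and.comp (Primrec.fst.comp Primrec.snd)
    (hp.comp Primrec.fst (Primrec.snd.comp Primrec.snd))

lemma primrec_list_any {f : α → List β} {p : α → β → Bool} (hf : Primrec f) (hp : Primrec₂ p) :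
    Primrec fun a => (f a).any (p a) := by
  refine (Primrec.not.comp (primrec_list_all hf (p := fun a b => !p a b)
    (Primrec.not.comp₂ hp))).of_eq fun a => ?_
  simp [List.not_all_eq_any_not]

lemma primrec_list_filter {f : α → List β} {p : α → β → Bool} (hf : Primrec f)
    (hp : Primrec₂ p) : Primrec fun a => (f a).filter (p a) := by
  refine (Primrec.listFilterMap hf (g := fun a b => bif p a b then some b else none) ?_).of_eq
    fun a => ?_
  · exact Primrec.cond hp (Primrec.option_some.comp Primrec.snd) (Primrec.const none)
  · rw [← List.filterMap_eq_filter]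
    congr 1
    funext b
    cases h : p a b <;> simp [Option.guard, h]

lemma primrec_pick {f : α → List β} {le : α → β → β → Bool} (hf : Primrec f)
    (hle : Primrec fun x : (α × β) × β => le x.1.1 x.1.2 x.2) :
    Primrec fun a => pick (le a) (f a) := by
  refine Primrec.list_head?.comp (primrec_list_filter hf ?_)
  refine primrec_list_all (hf.comp Primrec.fst) ?_
  exact hle.comp (Primrec.pair (Primrec.pair (Primrec.fst.comp Primrec.fst) Primrec.snd)
    (Primrec.snd.comp Primrec.fst))

lemma primrec_decide_lt {f g : α → ℕ} (hf : Primrec f) (hg : Primrec g) :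
    Primrec fun a => decide (f a < g a) := by
  have : PrimrecPred fun a => f a < g a := Primrec.nat_lt.comp hf hg
  exact this.decide

lemma primrec_decide_le {f g : α → ℕ} (hf : Primrec f) (hg : Primrec g) :
    Primrec fun a => decide (f a ≤ g a) := by
  have : PrimrecPred fun a => f a ≤ g a := Primrec.nat_le.comp hf hg
  exact this.decide

lemma primrec_decide_eq [DecidableEq β] {f g : α → β} (hf : Primrec f) (hg : Primrec g) :
    Primrec fun a => decide (f a = g a) := by
  have : PrimrecPred fun a => f a = g a := Primrec.eq.comp hf hg
  exact this.decide

lemma primrec_decide_prefix {f g : α → BStr} (hf : Primrec f) (hg : Primrec g) :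
    Primrec fun a => decide (f a <+: g a) := by
  refine (primrec_decide_eq hf
    (Primrec.list_take.comp (Primrec.list_length.comp hf) hg)).of_eq fun a => ?_
  rw [decide_eq_decide, List.prefix_iff_eq_take]

lemma primrec_isServed {live : α → BStr → Bool} {σ : α → BStr} {S : α → List Block}
    (hl : Primrec₂ live) (hσ : Primrec σ) (hS : Primrec S) :
    Primrec fun a => isServed (live a) (σ a) (S a) := by
  refine primrec_list_any hS ?_
  exact Primrec.and.comp (hl.comp Primrec.fst (Primrec.fst.comp Primrec.snd))
    (primrec_decide_prefix (hσ.comp Primrec.fst) (Primrec.snd.comp Primrec.snd))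

lemma primrec_isUsable {live : α → BStr → Bool} {j : α → BStr → ℕ} {σ : α → BStr}
    (hl : Primrec₂ live) (hj : Primrec₂ j) (hσ : Primrec σ) :
    Primrec₂ fun a b => isUsable (live a) (j a) (σ a) b := by
  have h1 : Primrec fun x : α × Block => x.2.1 := Primrec.fst.comp Primrec.snd
  have h2 : Primrec fun x : α × Block => x.2.2 := Primrec.snd.comp Primrec.snd
  have h3 : Primrec fun x : α × Block => σ x.1 := hσ.comp Primrec.fst
  refine Primrec.and.comp (hl.comp Primrec.fst h1) (Primrec.and.comp
    (primrec_decide_prefix h2 h3) (Primrec.and.comp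
    (primrec_decide_lt (Primrec.list_length.comp h2) (Primrec.list_length.comp h3))
    (primrec_list_all (Primrec.list_range.comp (Primrec.list_length.comp h3)) ?_)))
  refine Primrec.or.comp
    (primrec_decide_lt Primrec.snd (Primrec.list_length.comp (h2.comp Primrec.fst)))
    (primrec_decide_le (Primrec.list_length.comp (h1.comp Primrec.fst)) ?_)
  exact hj.comp (Primrec.fst.comp Primrec.fst)
    (Primrec.list_take.comp (Primrec.succ.comp Primrec.snd) (h3.comp Primrec.fst))

lemma primrec_blockLE {f g : α → Block} (hf : Primrec f) (hg : Primrec g) :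
    Primrec fun a => blockLE (f a) (g a) := by
  have h1 := Primrec.list_length.comp (Primrec.fst.comp hf)
  have h2 := Primrec.list_length.comp (Primrec.snd.comp hf)
  have h3 := Primrec.list_length.comp (Primrec.fst.comp hg)
  have h4 := Primrec.list_length.comp (Primrec.snd.comp hg)
  exact Primrec.or.comp (primrec_decide_lt h2 h4)
    (Primrec.and.comp (primrec_decide_eq h2 h4) (primrec_decide_le h1 h3))

lemma primrec_chooseBlock {live : α → BStr → Bool} {j : α → BStr → ℕ} {σ : α → BStr}
    {S : α → List Block} (hl : Primrec₂ live) (hj : Primrec₂ j) (hσ : Primrec σ)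
    (hS : Primrec S) : Primrec fun a => chooseBlock (live a) (j a) (σ a) (S a) :=
  primrec_pick (le := fun _ => blockLE) (primrec_list_filter hS (primrec_isUsable hl hj hσ))
    (primrec_blockLE (Primrec.snd.comp Primrec.fst) Primrec.snd)

lemma primrec_chooseIndex {j : α → BStr → ℕ} {σ : α → BStr} {t : α → ℕ}
    (hj : Primrec₂ j) (hσ : Primrec σ) (ht : Primrec t) :
    Primrec fun a => chooseIndex (j a) (σ a) (t a) := by
  have h1 : Primrec₂ fun (a : α) (i : ℕ) => j a ((σ a).take (i + 1)) :=
    hj.comp Primrec.fst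
      (Primrec.list_take.comp (Primrec.succ.comp Primrec.snd) (hσ.comp Primrec.fst))
  refine primrec_pick
    (le := fun a i i' => decide (j a ((σ a).take (i' + 1)) ≤ j a ((σ a).take (i + 1))))
    (primrec_list_filter (Primrec.list_range.comp (Primrec.list_length.comp hσ))
      (p := fun a i => decide (t a ≤ i)) ?_) ?_
  · exact primrec_decide_le (ht.comp Primrec.fst) Primrec.snd
  · exact primrec_decide_le (h1.comp (Primrec.fst.comp Primrec.fst) Primrec.snd)
      (h1.comp (Primrec.fst.comp Primrec.fst) (Primrec.snd.comp Primrec.fst))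

lemma primrec_halve {live : α → BStr → Bool} {τ : α → BStr}
    (hl : Primrec₂ live) (hτ : Primrec τ) : Primrec₂ fun a x => halve (live a) (τ a) x := by
  have h1 : Primrec fun x : α × (BStr × List Block) => x.2.1 := Primrec.fst.comp Primrec.snd
  have h2 : Primrec fun x : α × (BStr × List Block) => x.2.2 := Primrec.snd.comp Primrec.snd
  have h3 : Primrec fun x : α × (BStr × List Block) => live x.1 (x.2.1 ++ [false]) :=
    hl.comp Primrec.fst (Primrec.list_concat.comp h1 (Primrec.const false))
  exact Primrec.pair (Primrec.list_concat.comp h1 (Primrec.not.comp h3))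
    (Primrec.list_cons.comp
      (Primrec.pair (Primrec.list_concat.comp h1 h3) (hτ.comp Primrec.fst)) h2)

lemma primrec_reassign {live : α → BStr → Bool} {b : α → Block} {m : α → ℕ} {π : α → BStr}
    {x : α → AllocState} (hl : Primrec₂ live) (hb : Primrec b) (hm : Primrec m)
    (hπ : Primrec π) (hx : Primrec x) :
    Primrec fun a => reassign (live a) (b a) (m a) (π a) (x a) := by
  have h1 : Primrec fun a => (halve (live a) (b a).2)^[m a - (b a).1.length]
      ((b a).1, (x a).1.filter fun c => !decide (c = b a)) := by
    refine Primrec.nat_iterate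
      (Primrec.nat_sub.comp hm (Primrec.list_length.comp (Primrec.fst.comp hb)))
      (Primrec.pair (Primrec.fst.comp hb) (primrec_list_filter (Primrec.fst.comp hx) ?_))
      (primrec_halve hl (Primrec.snd.comp hb))
    exact Primrec.not.comp (primrec_decide_eq Primrec.snd (hb.comp Primrec.fst))
  have h2 := Primrec.pair (Primrec.fst.comp h1) hπ
  exact Primrec.pair (Primrec.list_cons.comp h2 (Primrec.snd.comp h1))
    (Primrec.list_cons.comp h2 (Primrec.snd.comp hx))

lemma primrec_serveStep {live : α → BStr → Bool} {j : α → BStr → ℕ} {σ : α → BStr}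
    {x : α → AllocState} (hl : Primrec₂ live) (hj : Primrec₂ j) (hσ : Primrec σ)
    (hx : Primrec x) : Primrec fun a => serveStep (live a) (j a) (σ a) (x a) := by
  have hS := Primrec.fst.comp hx
  have h1 : Primrec fun a => Option.casesOn (motive := fun _ => AllocState)
      (chooseBlock (live a) (j a) (σ a) (x a).1) (x a) fun b =>
      Option.casesOn (motive := fun _ => AllocState)
        (chooseIndex (j a) (σ a) b.2.length) (x a) fun i =>
        reassign (live a) b (j a ((σ a).take (i + 1))) ((σ a).take (i + 1)) (x a) := by
    refine Primrec.option_casesOn (primrec_chooseBlock hl hj hσ hS) hx ?_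
    refine Primrec.option_casesOn
      (primrec_chooseIndex (hj.comp (Primrec.fst.comp Primrec.fst) Primrec.snd)
        (hσ.comp Primrec.fst) (Primrec.list_length.comp (Primrec.snd.comp Primrec.snd)))
      (hx.comp Primrec.fst) ?_
    have g1 : Primrec fun y : (α × Block) × ℕ => y.1.1 := Primrec.fst.comp Primrec.fst
    have g2 : Primrec fun y : (α × Block) × ℕ => (σ y.1.1).take (y.2 + 1) :=
      Primrec.list_take.comp (Primrec.succ.comp Primrec.snd) (hσ.comp g1)
    exact primrec_reassign (hl.comp (g1.comp Primrec.fst) Primrec.snd)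
      (Primrec.snd.comp Primrec.fst) (hj.comp g1 g2) g2 (hx.comp g1)
  refine (Primrec.cond (primrec_isServed hl hσ hS) hx h1).of_eq fun a => ?_
  unfold serveStep
  cases isServed (live a) (σ a) (x a).1
  · simp only [cond_false, Bool.false_eq_true, if_false]
    cases chooseBlock (live a) (j a) (σ a) (x a).1 with
    | none => rfl
    | some b =>
      simp only
      cases chooseIndex (j a) (σ a) b.2.length <;> rfl
  · rfl

lemma primrec_serve {live : α → BStr → Bool} {j : α → BStr → ℕ} {σ : α → BStr}
    {x : α → AllocState} (hl : Primrec₂ live) (hj : Primrec₂ j) (hσ : Primrec σ)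
    (hx : Primrec x) : Primrec fun a => serve (live a) (j a) (σ a) (x a) := by
  refine Primrec.nat_iterate (Primrec.list_length.comp hσ) hx
    (h := fun a x => serveStep (live a) (j a) (σ a) x) ?_
  exact primrec_serveStep (hl.comp (Primrec.fst.comp Primrec.fst) Primrec.snd)
    (hj.comp (Primrec.fst.comp Primrec.fst) Primrec.snd) (hσ.comp Primrec.fst) Primrec.snd

lemma primrec_allocState {live : ℕ → BStr → Bool} {J : ℕ → BStr → ℕ} {E : ℕ → List BStr}
    (hl : Primrec₂ live) (hJ : Primrec₂ J) (hE : Primrec E) :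
    Primrec (allocState live J E) := by
  have h1 : Primrec₂ fun (s : ℕ) (x : AllocState) =>
      (E s).foldl (fun x σ => serve (live s) (J s) σ x) x := by
    refine Primrec.list_foldl (hE.comp Primrec.fst) Primrec.snd
      (h := fun (a : ℕ × AllocState) y => serve (live a.1) (J a.1) y.2 y.1) ?_
    have g1 : Primrec fun y : (ℕ × AllocState) × (AllocState × BStr) => y.1.1 :=
      Primrec.fst.comp Primrec.fst
    exact primrec_serve (hl.comp (g1.comp Primrec.fst) Primrec.snd)
      (hJ.comp (g1.comp Primrec.fst) Primrec.snd) (Primrec.snd.comp Primrec.snd)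
      (Primrec.fst.comp Primrec.snd)
  refine (Primrec.nat_rec₁ (([([], [])], [([], [])]) : AllocState) h1).of_eq fun s => ?_
  induction s with
  | zero => rfl
  | succ s ih => simp only [allocState, ← ih]

end PrimrecAlloc

/-! ### Stage approximations -/

lemma exists_primrec_approx {α β : Type*} [Primcodable α] [Primcodable β] {f : α →. β}
    (hf : Partrec f) : ∃ F : ℕ → α → Option β, Primrec₂ F ∧
      (∀ s t a b, s ≤ t → F s a = some b → F t a = some b) ∧
      ∀ a b, b ∈ f a ↔ ∃ s, F s a = some b := by
  obtain ⟨c, hc⟩ := Nat.Partrec.Code.exists_code.1 hf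
  refine ⟨fun s a => (Nat.Partrec.Code.evaln s c (Encodable.encode a)).bind Encodable.decode,
    ?_, ?_, ?_⟩
  · refine Primrec.option_bind ?_ (Primrec.decode.comp Primrec.snd)
    exact Nat.Partrec.Code.primrec_evaln.comp (Primrec.pair
      (Primrec.pair Primrec.fst (Primrec.const c)) (Primrec.encode.comp Primrec.snd))
  · intro s t a b hst h
    obtain ⟨y, hy, hb⟩ := Option.bind_eq_some_iff.1 h
    exact Option.bind_eq_some_iff.2 ⟨y, Nat.Partrec.Code.evaln_mono hst hy, hb⟩
  · intro a b
    have h1 : ∀ y, (∃ s, Nat.Partrec.Code.evaln s c (Encodable.encode a) = some y) ↔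
        ∃ b ∈ f a, Encodable.encode b = y := by
      intro y
      have := Nat.Partrec.Code.evaln_complete (c := c) (n := Encodable.encode a) (x := y)
      rw [hc] at this
      rw [show (∃ s, Nat.Partrec.Code.evaln s c (Encodable.encode a) = some y) ↔ _ from this.symm]
      simp
    constructor
    · intro hb
      obtain ⟨s, hs⟩ := (h1 (Encodable.encode b)).2 ⟨b, hb, rfl⟩
      exact ⟨s, Option.bind_eq_some_iff.2 ⟨_, hs, Encodable.encodek b⟩⟩
    · rintro ⟨s, hs⟩
      obtain ⟨y, hy, hb⟩ := Option.bind_eq_some_iff.1 hs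
      obtain ⟨b', hb', rfl⟩ := (h1 y).1 ⟨s, hy⟩
      rw [Encodable.encodek, Option.some.injEq] at hb
      exact hb ▸ hb'

lemma sum_overlap_le {S : Finset BStr} (hS : PrefixFreeSet (S : Set BStr)) (N : ℕ) (ρ : BStr)
    (hN : ∀ v ∈ S, v.length ≤ ρ.length + N) : ∑ v ∈ S, overlap v ρ ≤ (1 / 2) ^ ρ.length := by
  have base : ∀ ρ, ∀ v ∈ S, v <+: ρ → ∑ v ∈ S, overlap v ρ ≤ (1 / 2) ^ ρ.length := by
    intro ρ v hv hp
    rw [Finset.sum_eq_single_of_mem v hv, overlap_of_prefix hp]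
    intro w hw hne
    apply overlap_of_not
    · intro hwp
      rcases List.prefix_or_prefix_of_prefix hwp hp with h | h
      · exact hne (hS w hw v hv h)
      · exact hne (hS v hv w hw h).symm
    · intro hwp
      exact hne (hS v hv w hw (hp.trans hwp)).symm
  induction N generalizing ρ with
  | zero =>
    by_cases h : ∃ v ∈ S, v <+: ρ
    · obtain ⟨v, hv, hp⟩ := h
      exact base ρ v hv hp
    · push Not at h
      rw [Finset.sum_eq_zero]
      · positivity
      · intro v hv
        refine overlap_of_not (h v hv) fun hp => h v hv ?_
        rw [hp.eq_of_length_le (hN v hv)]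
  | succ N ih =>
    by_cases h : ∃ v ∈ S, v <+: ρ
    · obtain ⟨v, hv, hp⟩ := h
      exact base ρ v hv hp
    · simp_rw [overlap_split _ ρ false, Finset.sum_add_distrib, Bool.not_false]
      have key : ∀ c : Bool, ∑ v ∈ S, overlap v (ρ ++ [c]) ≤ (1 / 2) ^ (ρ.length + 1) := by
        intro c
        have := ih (ρ ++ [c]) (by simpa [add_assoc, add_comm, add_left_comm] using hN)
        simpa using this
      have h1 := key false
      have h2 := key true
      rw [pow_succ] at h1 h2
      linarith

/-- Kraft's inequality for finite prefix-free sets. -/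
lemma sum_half_pow_le_one {S : Finset BStr} (hS : PrefixFreeSet (S : Set BStr)) :
    ∑ v ∈ S, (1 / 2 : ℝ) ^ v.length ≤ 1 := by
  have := sum_overlap_le hS (S.sup List.length) [] fun v hv => by
    simpa using Finset.le_sup (f := List.length) hv
  simpa [overlap_of_prefix_right] using this

/-- The strings of length at most `s` seen by stage `s` to have short descriptions, together
with these descriptions; `n` codes the description. -/
def describe (F : ℕ → BStr → Option BStr) (s n : ℕ) : Option (BStr × BStr) :=
  (Encodable.decode₂ BStr n).bind fun ρ => (F s ρ).bind fun v =>
    bif decide (ρ.length + 2 < v.length) && decide (v.length ≤ s) then some (ρ, v) else none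

lemma describe_eq_some {F : ℕ → BStr → Option BStr} {s n : ℕ} {ρ v : BStr} :
    describe F s n = some (ρ, v) ↔ Encodable.encode ρ = n ∧ F s ρ = some v ∧
      ρ.length + 2 < v.length ∧ v.length ≤ s := by
  simp only [describe, Option.bind_eq_some_iff, Encodable.decode₂_eq_some]
  constructor
  · rintro ⟨ρ', h1, v', h2, h3⟩
    cases hb : decide (ρ'.length + 2 < v'.length) && decide (v'.length ≤ s)
    · rw [hb, cond_false] at h3
      exact absurd h3 (by simp)
    · rw [hb, cond_true, Option.some.injEq, Prod.mk.injEq] at h3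
      obtain ⟨rfl, rfl⟩ := h3
      rw [Bool.and_eq_true, decide_eq_true_eq, decide_eq_true_eq] at hb
      exact ⟨h1, h2, hb⟩
  · rintro ⟨h1, h2, h3, h4⟩
    exact ⟨ρ, h1, v, h2, by simp [h3, h4]⟩

/-- The strings seen by stage `s` to be compressible. -/
def compressed (F : ℕ → BStr → Option BStr) (s : ℕ) : List BStr :=
  ((List.range s).filterMap (describe F s)).map Prod.snd

lemma mem_compressed {F : ℕ → BStr → Option BStr} {s : ℕ} {v : BStr} :
    v ∈ compressed F s ↔ ∃ ρ : BStr, Encodable.encode ρ < s ∧ F s ρ = some v ∧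
      ρ.length + 2 < v.length ∧ v.length ≤ s := by
  simp only [compressed, List.mem_map, List.mem_filterMap, List.mem_range]
  constructor
  · rintro ⟨⟨ρ, v'⟩, ⟨n, hn, h⟩, rfl⟩
    have h' := describe_eq_some.1 h
    exact ⟨ρ, h'.1 ▸ hn, h'.2⟩
  · rintro ⟨ρ, hn, h⟩
    exact ⟨(ρ, v), ⟨_, hn, describe_eq_some.2 ⟨rfl, h⟩⟩, rfl⟩

lemma filterMap_sublist_filterMap {α β : Type*} {f g : α → Option β}
    (h : ∀ a b, f a = some b → g a = some b) (l : List α) :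
    (l.filterMap f).Sublist (l.filterMap g) := by
  induction l with
  | nil => simp
  | cons a l ih =>
    rw [List.filterMap_cons, List.filterMap_cons]
    cases hf : f a with
    | none =>
      cases g a with
      | none => exact ih
      | some b => exact ih.cons b
    | some b =>
      rw [h a b hf]
      exact ih.cons_cons b

lemma compressed_sublist {F : ℕ → BStr → Option BStr}
    (hF : ∀ s t a b, s ≤ t → F s a = some b → F t a = some b) (s : ℕ) :
    (compressed F s).Sublist (compressed F (s + 1)) := by
  refine List.Sublist.map _ (List.Sublist.trans (filterMap_sublist_filterMap ?_ _)
    (List.Sublist.filterMap _ (List.range_sublist.2 (Nat.le_succ s))))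
  rintro n ⟨ρ, v⟩ h
  rw [describe_eq_some] at h ⊢
  exact ⟨h.1, hF _ _ _ _ (Nat.le_succ s) h.2.1, h.2.2.1, h.2.2.2.trans (Nat.le_succ s)⟩

lemma compressed_weight {U : BStr →. BStr} (hU : PrefixFreeSet {ρ | (U ρ).Dom})
    {F : ℕ → BStr → Option BStr} (hF : ∀ a b, b ∈ U a ↔ ∃ s, F s a = some b) (s : ℕ) :
    ((compressed F s).map fun v : BStr => (1 / 2 : ℝ) ^ v.length).sum < 1 / 4 := by
  set P := (List.range s).filterMap (describe F s) with hP
  have hmem : ∀ p ∈ P, F s p.1 = some p.2 ∧ p.1.length + 2 < p.2.length := by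
    rintro ⟨ρ, v⟩ hp
    obtain ⟨n, -, hn⟩ := List.mem_filterMap.1 hp
    obtain ⟨-, h1, h2, -⟩ := describe_eq_some.1 hn
    exact ⟨h1, h2⟩
  have hnodup : (P.map Prod.fst).Nodup := by
    rw [hP, List.map_filterMap]
    refine List.Nodup.filterMap ?_ List.nodup_range
    intro a a' ρ h1 h2
    simp only [Option.mem_def, Option.map_eq_some_iff, Prod.exists, exists_and_right,
      exists_eq_right] at h1 h2
    obtain ⟨v, h1⟩ := h1
    obtain ⟨v', h2⟩ := h2
    exact (describe_eq_some.1 h1).1.symm.trans (describe_eq_some.1 h2).1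
  have hkraft : ((P.map Prod.fst).map fun ρ : BStr => (1 / 2 : ℝ) ^ ρ.length).sum ≤ 1 := by
    rw [← List.sum_toFinset _ hnodup]
    apply sum_half_pow_le_one
    have hdom : ∀ ρ ∈ (P.map Prod.fst).toFinset, (U ρ).Dom := by
      intro ρ hρ
      obtain ⟨p, hp, rfl⟩ := List.mem_map.1 (List.mem_toFinset.1 hρ)
      exact Part.dom_iff_mem.2 ⟨_, (hF _ _).2 ⟨s, (hmem p hp).1⟩⟩
    exact fun σ hσ τ hτ h => hU σ (hdom σ hσ) τ (hdom τ hτ) h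
  have h1 : ((compressed F s).map fun v : BStr => (1 / 2 : ℝ) ^ v.length).sum ≤
      (P.map fun p => (1 / 8 : ℝ) * (1 / 2) ^ p.1.length).sum := by
    rw [compressed, List.map_map]
    apply List.sum_le_sum
    intro p hp
    calc (1 / 2 : ℝ) ^ p.2.length ≤ (1 / 2) ^ (3 + p.1.length) :=
          pow_le_pow_of_le_one (by norm_num) (by norm_num) (by have := (hmem p hp).2; omega)
      _ = _ := by rw [pow_add]; norm_num
  rw [List.sum_map_mul_left] at h1
  rw [List.map_map] at hkraft
  have h2 : (P.map fun p => (1 / 2 : ℝ) ^ p.1.length).sum ≤ 1 := hkraft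
  linarith

/-- The overlap of `v` with `ρ`, rescaled to a natural number when `v` has length at most `s`. -/
def natOverlap (s : ℕ) (v ρ : BStr) : ℕ :=
  bif decide (v <+: ρ) then 2 ^ s else
    bif decide (ρ <+: v) then 2 ^ (s + ρ.length - v.length) else 0

lemma natOverlap_eq {s : ℕ} {v ρ : BStr} (h : v.length ≤ s) :
    (natOverlap s v ρ : ℝ) = 2 ^ (s + ρ.length) * overlap v ρ := by
  unfold natOverlap
  by_cases h1 : v <+: ρ
  · rw [overlap_of_prefix h1, pow_add, mul_assoc, ← mul_pow]
    simp [h1]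
  · by_cases h2 : ρ <+: v
    · rw [overlap_of_prefix_right h2]
      have : s + ρ.length = (s + ρ.length - v.length) + v.length := by omega
      rw [this, pow_add, mul_assoc, ← mul_pow]
      simp [h1, h2]
    · rw [overlap_of_not h1 h2]
      simp [h1, h2]

/-- The cylinder of `ρ` is not exhausted by the strings compressed by stage `s`. -/
def stageLive (F : ℕ → BStr → Option BStr) (s : ℕ) (ρ : BStr) : Bool :=
  decide ((compressed F s).foldl (fun a v => a + natOverlap s v ρ) 0 < 2 ^ s)

lemma foldl_natOverlap {s : ℕ} {ρ : BStr} (V : List BStr) (hV : ∀ v ∈ V, v.length ≤ s) (a : ℕ) :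
    ((V.foldl (fun a v => a + natOverlap s v ρ) a : ℕ) : ℝ) =
      a + 2 ^ (s + ρ.length) * (V.map fun v => overlap v ρ).sum := by
  induction V generalizing a with
  | nil => simp
  | cons v V ih =>
    rw [List.foldl_cons, ih fun w hw => hV w (List.mem_cons_of_mem _ hw), Nat.cast_add,
      natOverlap_eq (hV v (List.mem_cons_self ..)), List.map_cons, List.sum_cons]
    ring

lemma stageLive_iff {F : ℕ → BStr → Option BStr} {s : ℕ} {ρ : BStr} :
    stageLive F s ρ = true ↔
      ((compressed F s).map fun v => overlap v ρ).sum < (1 / 2) ^ ρ.length := by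
  have h1 := foldl_natOverlap (s := s) (ρ := ρ) (compressed F s)
    (fun v hv => by obtain ⟨_, _, _, _, h⟩ := mem_compressed.1 hv; exact h) 0
  rw [stageLive, decide_eq_true_eq, ← Nat.cast_lt (α := ℝ), h1]
  have h2 : ((2 ^ s : ℕ) : ℝ) = 2 ^ (s + ρ.length) * (1 / 2) ^ ρ.length := by
    rw [pow_add, mul_assoc, ← mul_pow]; simp
  rw [h2, Nat.cast_zero, zero_add, mul_lt_mul_iff_right₀ (by positivity)]

/-- The nonempty strings seen by stage `s` to have all their nonempty prefixes in the domain. -/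
def stageDomain (G : ℕ → BStr → Option ℕ) (s : ℕ) : List BStr :=
  ((List.range s).filterMap (Encodable.decode₂ BStr)).filter fun σ =>
    !decide (σ = []) && (List.range σ.length).all fun i => (G s (σ.take (i + 1))).isSome

lemma mem_stageDomain {G : ℕ → BStr → Option ℕ} {s : ℕ} {σ : BStr} :
    σ ∈ stageDomain G s ↔ Encodable.encode σ < s ∧ σ ≠ [] ∧
      ∀ i, 0 < i → i ≤ σ.length → ∃ m, G s (σ.take i) = some m := by
  simp only [stageDomain, List.mem_filter, List.mem_filterMap, List.mem_range,
    Encodable.decode₂_eq_some, exists_eq_right', Bool.and_eq_true, Bool.not_eq_true',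
    decide_eq_false_iff_not, List.all_eq_true, Option.isSome_iff_exists]
  refine and_congr_right fun _ => and_congr_right fun _ => ?_
  constructor
  · intro h i hi hil
    have := h (i - 1) (by omega)
    rwa [Nat.sub_add_cancel (by omega)] at this
  · exact fun h i hi => h (i + 1) (by omega) (by omega)

lemma exists_mem_stageDomain {G : ℕ → BStr → Option ℕ}
    (hG : ∀ s t a b, s ≤ t → G s a = some b → G t a = some b) {σ : BStr} (hσ : σ ≠ [])
    (hdom : ∀ i, 0 < i → i ≤ σ.length → ∃ s m, G s (σ.take i) = some m) :
    ∃ s₀, ∀ s, s₀ ≤ s → σ ∈ stageDomain G s := by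
  choose! f m hf using hdom
  refine ⟨max (Encodable.encode σ + 1) ((Finset.range (σ.length + 1)).sup f), fun s hs => ?_⟩
  refine mem_stageDomain.2 ⟨by omega, hσ, fun i hi hil => ⟨m i, hG _ _ _ _ ?_ (hf i hi hil)⟩⟩
  exact (Finset.le_sup (Finset.mem_range.2 (by omega))).trans ((le_max_right _ _).trans hs)

lemma primrec_pow {α : Type*} [Primcodable α] {f : α → ℕ} (hf : Primrec f) :
    Primrec fun a => 2 ^ f a := by
  refine (Primrec.nat_iterate hf (Primrec.const 1) (h := fun _ x => 2 * x) ?_).of_eq fun a => ?_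
  · exact Primrec.nat_mul.comp (Primrec.const 2) Primrec.snd
  · simp [mul_left_iterate]

lemma primrec_compressed {F : ℕ → BStr → Option BStr} (hF : Primrec₂ F) :
    Primrec (compressed F) := by
  refine Primrec.list_map (Primrec.listFilterMap Primrec.list_range ?_)
    (Primrec.snd.comp Primrec.snd)
  refine Primrec.option_bind (Primrec.decode₂.comp Primrec.snd) ?_
  refine Primrec.option_bind
    (hF.comp (Primrec.fst.comp Primrec.fst) Primrec.snd) ?_
  have h1 : Primrec fun x : ((ℕ × ℕ) × BStr) × BStr => x.1.2 := Primrec.snd.comp Primrec.fst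
  have h2 : Primrec fun x : ((ℕ × ℕ) × BStr) × BStr => x.2 := Primrec.snd
  have h3 : Primrec fun x : ((ℕ × ℕ) × BStr) × BStr => x.1.1.1 :=
    Primrec.fst.comp (Primrec.fst.comp Primrec.fst)
  exact Primrec.cond (Primrec.and.comp
    (primrec_decide_lt (Primrec.nat_add.comp (Primrec.list_length.comp h1) (Primrec.const 2))
      (Primrec.list_length.comp h2)) (primrec_decide_le (Primrec.list_length.comp h2) h3))
    (Primrec.option_some.comp (Primrec.pair h1 h2)) (Primrec.const none)

lemma primrec_stageLive {F : ℕ → BStr → Option BStr} (hF : Primrec₂ F) :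
    Primrec₂ (stageLive F) := by
  refine primrec_decide_lt (Primrec.list_foldl ((primrec_compressed hF).comp Primrec.fst)
    (Primrec.const 0)
    (h := fun (x : ℕ × BStr) (y : ℕ × BStr) => y.1 + natOverlap x.1 y.2 x.2) ?_)
    (primrec_pow Primrec.fst)
  have h1 : Primrec fun x : (ℕ × BStr) × (ℕ × BStr) => x.1.1 := Primrec.fst.comp Primrec.fst
  have h2 : Primrec fun x : (ℕ × BStr) × (ℕ × BStr) => x.1.2 := Primrec.snd.comp Primrec.fst
  have h3 : Primrec fun x : (ℕ × BStr) × (ℕ × BStr) => x.2.1 := Primrec.fst.comp Primrec.snd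
  have h4 : Primrec fun x : (ℕ × BStr) × (ℕ × BStr) => x.2.2 := Primrec.snd.comp Primrec.snd
  exact Primrec.nat_add.comp h3 (Primrec.cond (primrec_decide_prefix h4 h2) (primrec_pow h1)
    (Primrec.cond (primrec_decide_prefix h2 h4)
      (primrec_pow (Primrec.nat_sub.comp
        (Primrec.nat_add.comp h1 (Primrec.list_length.comp h2)) (Primrec.list_length.comp h4)))
      (Primrec.const 0)))

lemma primrec_stageDomain {G : ℕ → BStr → Option ℕ} (hG : Primrec₂ G) :
    Primrec (stageDomain G) := by
  refine primrec_list_filter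
    (Primrec.listFilterMap Primrec.list_range (Primrec.decode₂.comp Primrec.snd)) ?_
  refine Primrec.and.comp
    (Primrec.not.comp (primrec_decide_eq Primrec.snd (Primrec.const []))) ?_
  refine primrec_list_all (Primrec.list_range.comp (Primrec.list_length.comp Primrec.snd)) ?_
  exact Primrec.option_isSome.comp (hG.comp (Primrec.fst.comp Primrec.fst)
    (Primrec.list_take.comp (Primrec.succ.comp Primrec.snd) (Primrec.snd.comp Primrec.fst)))

/-- A prefix-free machine and a summable family of requests give rise to a primitive recursive
instance of the allocation process. -/
lemma exists_allocData {U : BStr →. BStr} (hU : PrefixFreeMachine U) {I : BStr →. ℕ}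
    (hI : Partrec I) {c : ℕ} {I' : BStr → ℕ} (hI' : ∀ σ, ∀ m ∈ I σ, I' σ = m + c)
    (hsum : ∀ T : Finset BStr, (∀ τ ∈ T, (I τ).Dom) → ∑ τ ∈ T, (1 / 2 : ℝ) ^ I' τ ≤ 1 / 4) :
    ∃ (live : ℕ → BStr → Bool) (J : ℕ → BStr → ℕ) (E V : ℕ → List BStr),
      Primrec (allocState live J E) ∧ AllocData live J E V I' {σ | (I σ).Dom} ∧
      (∀ σ, σ ≠ [] → (∀ i, 0 < i → i ≤ σ.length → (I (σ.take i)).Dom) →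
        ∃ s₀, ∀ s, s₀ ≤ s → σ ∈ E s) ∧
      ∀ ρ v, v ∈ U ρ → ρ.length + 2 < v.length → ∃ s, v ∈ V s := by
  obtain ⟨F, hF1, hF2, hF3⟩ := exists_primrec_approx hU.1
  obtain ⟨G, hG1, hG2, hG3⟩ := exists_primrec_approx hI
  have hJ : Primrec₂ fun s σ => (G s σ).getD 0 + c :=
    Primrec.nat_add.comp (Primrec.option_getD.comp hG1 (Primrec.const 0)) (Primrec.const c)
  refine ⟨stageLive F, fun s σ => (G s σ).getD 0 + c, stageDomain G, compressed F,
    primrec_allocState (primrec_stageLive hF1) hJ (primrec_stageDomain hG1), ?_, ?_, ?_⟩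
  · refine ⟨fun s => ⟨fun ρ => stageLive_iff, compressed_weight hU.2 hF3 s⟩,
      compressed_sublist hF2, hsum, fun s σ hσ => (mem_stageDomain.1 hσ).2.1, ?_, ?_⟩
    · intro s σ hσ i hi hil
      obtain ⟨m, hm⟩ := (mem_stageDomain.1 hσ).2.2 i hi hil
      exact Part.dom_iff_mem.2 ⟨m, (hG3 _ _).2 ⟨s, hm⟩⟩
    · intro s σ hσ i hi hil
      obtain ⟨m, hm⟩ := (mem_stageDomain.1 hσ).2.2 i hi hil
      rw [hI' _ m ((hG3 _ _).2 ⟨s, hm⟩), hm, Option.getD_some]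
  · intro σ hσ hdom
    refine exists_mem_stageDomain hG2 hσ fun i hi hil => ?_
    obtain ⟨m, hm⟩ := Part.dom_iff_mem.1 (hdom i hi hil)
    obtain ⟨s, hs⟩ := (hG3 _ _).1 hm
    exact ⟨s, m, hs⟩
  · intro ρ v hv hlt
    obtain ⟨s, hs⟩ := (hF3 _ _).1 hv
    refine ⟨max s (max (Encodable.encode ρ + 1) v.length), mem_compressed.2 ⟨ρ, by omega, ?_,
      hlt, by omega⟩⟩
    exact hF2 _ _ _ _ (le_max_left _ _) hs

/-! ### Decoding and randomness -/

lemma stake_add (Y : ℕ → Bool) (c m : ℕ) :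
    stake Y (c + m) = stake Y c ++ stake (fun k => Y (c + k)) m := by
  simp [stake, List.range_add, List.map_map, Function.comp_def]

/-- Search the logs for a sufficiently long label on the path `w ++ q`. -/
def decoder (L : ℕ → List Block) (w : BStr) (p : ℕ × BStr) : Part BStr :=
  Nat.rfindOpt fun s => ((L s).filter fun e =>
    decide (e.1 <+: w ++ p.2) && decide (p.1 ≤ e.2.length)).head?.map fun e => e.2.take p.1

lemma partrec_decoder {L : ℕ → List Block} (hL : Primrec L) (w : BStr) :
    Partrec (decoder L w) := by
  refine Partrec.rfindOpt (Primrec.to_comp ?_)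
  refine Primrec.option_map (Primrec.list_head?.comp
    (primrec_list_filter (hL.comp Primrec.snd) (p := fun (x : (ℕ × BStr) × ℕ) e =>
      decide (e.1 <+: w ++ x.1.2) && decide (x.1.1 ≤ e.2.length)) ?_)) ?_
  · have h1 : Primrec fun x : ((ℕ × BStr) × ℕ) × Block => x.1.1 := Primrec.fst.comp Primrec.fst
    exact Primrec.and.comp
      (primrec_decide_prefix (Primrec.fst.comp Primrec.snd)
        (Primrec.list_append.comp (Primrec.const w) (Primrec.snd.comp h1)))
      (primrec_decide_le (Primrec.fst.comp h1)
        (Primrec.list_length.comp (Primrec.snd.comp Primrec.snd)))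
  · exact Primrec.list_take.comp (Primrec.fst.comp (Primrec.fst.comp Primrec.fst))
      (Primrec.snd.comp Primrec.snd)

lemma mem_decoder {L : ℕ → List Block} {w q σ : BStr}
    (hL : ∀ s t, ∀ e ∈ L s, ∀ e' ∈ L t, e.1 <+: w ++ q → e'.1 <+: w ++ q →
      e.2 <+: e'.2 ∨ e'.2 <+: e.2)
    {s : ℕ} {e : Block} (he : e ∈ L s) (h1 : e.1 <+: w ++ q) (h2 : σ <+: e.2) :
    σ ∈ decoder L w (σ.length, q) := by
  have hspec : ∀ t (a : BStr), a ∈ ((L t).filter fun e =>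
      decide (e.1 <+: w ++ q) && decide (σ.length ≤ e.2.length)).head?.map
        (fun e => e.2.take σ.length) → a = σ := by
    intro t a ha
    obtain ⟨e', he', rfl⟩ := Option.map_eq_some_iff.1 ha
    have hm := List.mem_filter.1 (List.mem_of_head? he')
    rw [Bool.and_eq_true, decide_eq_true_eq, decide_eq_true_eq] at hm
    obtain ⟨hm1, hm2, hm3⟩ := hm
    have hp : σ <+: e'.2 := by
      rcases hL s t e he e' hm1 h1 hm2 with h | h
      · exact h2.trans h
      · exact List.prefix_of_prefix_length_le h2 h hm3
    exact (List.prefix_iff_eq_take.1 hp).symm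
  have hdom : (decoder L w (σ.length, q)).Dom := by
    refine Nat.rfindOpt_dom.2 ⟨s, ?_⟩
    have hne : ((L s).filter fun e =>
        decide (e.1 <+: w ++ q) && decide (σ.length ≤ e.2.length)) ≠ [] :=
      List.ne_nil_of_mem (a := e) (List.mem_filter.2 ⟨he, by simp [h1, h2.length_le]⟩)
    exact ⟨_, Option.mem_map.2 ⟨_, List.head?_eq_some_head hne, rfl⟩⟩
  obtain ⟨a, ha⟩ := Part.dom_iff_mem.1 hdom
  obtain ⟨t, ht⟩ := Nat.rfindOpt_spec ha
  rwa [hspec t a ht] at ha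

lemma KM_le {M : BStr →. BStr} {ρ σ : BStr} (h : σ ∈ M ρ) : KM M σ ≤ ρ.length :=
  sInf_le ⟨ρ, h, rfl⟩

lemma exists_of_KM_ne_top {M : BStr →. BStr} {σ : BStr} (h : KM M σ ≠ ⊤) :
    ∃ ρ, σ ∈ M ρ ∧ KM M σ = ρ.length := by
  have hne : ((fun ρ : BStr => (ρ.length : ℕ∞)) '' {ρ | σ ∈ M ρ}).Nonempty := by
    by_contra hc
    rw [Set.not_nonempty_iff_eq_empty] at hc
    exact h (by rw [KM, hc, sInf_empty])
  obtain ⟨ρ, hρ, heq⟩ := csInf_mem hne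
  exact ⟨ρ, hρ, heq.symm⟩

lemma UniversalPFM.KM_ne_top {U : BStr →. BStr} (hU : UniversalPFM U) (σ : BStr) :
    KM U σ ≠ ⊤ := by
  let M : BStr →. BStr := fun ρ => ((if ρ = [] then some σ else none : Option BStr) : Part BStr)
  have hM : PrefixFreeMachine M := by
    refine ⟨Computable.ofOption (Primrec.to_comp (Primrec.ite
      (Primrec.eq.comp Primrec.id (Primrec.const [])) (Primrec.const (some σ))
      (Primrec.const none))), ?_⟩
    have key : ∀ ρ, (M ρ).Dom → ρ = [] := by
      intro ρ hρ
      by_contra hne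
      simp [M, hne] at hρ
    intro ρ hρ τ hτ _
    rw [key ρ hρ, key τ hτ]
  obtain ⟨c, hc⟩ := hU.2 M hM
  have h1 : KM M σ ≤ (([] : BStr).length : ℕ∞) := KM_le (by simp [M])
  have h2 := (hc σ).trans (add_le_add_left h1 (c : ℕ∞))
  exact ne_top_of_le_ne_top (ENat.natCast_ne_top (0 + c)) (by simpa using h2)

lemma UniversalPFM.exists_description {U : BStr →. BStr} (hU : UniversalPFM U) (σ : BStr) :
    ∃ ρ, σ ∈ U ρ ∧ ρ.length = Kof U σ := by
  obtain ⟨ρ, hρ, h⟩ := exists_of_KM_ne_top (hU.KM_ne_top σ)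
  exact ⟨ρ, hρ, by rw [Kof, h, ENat.toNat_natCast]⟩

/-- Prepending a fixed string increases complexity by at most a constant. -/
lemma UniversalPFM.exists_Kof_append_le {U : BStr →. BStr} (hU : UniversalPFM U) (w : BStr) :
    ∃ c, ∀ σ, Kof U (w ++ σ) ≤ Kof U σ + c := by
  have hM : PrefixFreeMachine fun ρ => (U ρ).map fun σ => w ++ σ := by
    refine ⟨hU.1.1.map (Primrec.to_comp
      (Primrec.list_append.comp (Primrec.const w) Primrec.snd)), ?_⟩
    exact hU.1.2
  obtain ⟨c, hc⟩ := hU.2 _ hM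
  refine ⟨c, fun σ => ?_⟩
  obtain ⟨ρ, hρ, hlen⟩ := hU.exists_description σ
  have h1 := (hc (w ++ σ)).trans
    (add_le_add_left (KM_le (ρ := ρ) (Part.mem_map _ hρ)) (c : ℕ∞))
  rw [← ENat.natCast_toNat (hU.KM_ne_top (w ++ σ))] at h1
  rw [← hlen]
  exact_mod_cast h1

lemma UniversalPFM.mlRandom_shift {U : BStr →. BStr} (hU : UniversalPFM U) {Y : ℕ → Bool}
    (hY : MLRandom U Y) (c : ℕ) : MLRandom U fun k => Y (c + k) := by
  obtain ⟨d, hd⟩ := hY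
  obtain ⟨a, ha⟩ := hU.exists_Kof_append_le (stake Y c)
  refine ⟨a + d, fun n => ?_⟩
  have h1 := hd (c + n)
  have h2 := ha (stake (fun k => Y (c + k)) n)
  rw [stake_add] at h1
  omega

lemma toReal_iweight {I : BStr →. ℕ} {σ : BStr} (h : (I σ).Dom) :
    (iweight I σ).toReal = (1 / 2) ^ (I σ).get h := by
  simp [iweight, h]

/-- Requests of finite total weight can be shifted by a constant to have small total weight. -/
lemma exists_shift {I : BStr →. ℕ} (hsum : (∑' σ : BStr, iweight I σ) < ⊤) :
    ∃ (c : ℕ) (I' : BStr → ℕ), (∀ σ, ∀ m ∈ I σ, I' σ = m + c) ∧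
      ∀ T : Finset BStr, (∀ τ ∈ T, (I τ).Dom) → ∑ τ ∈ T, (1 / 2 : ℝ) ^ I' τ ≤ 1 / 4 := by
  classical
  obtain ⟨c, hc⟩ : ∃ c : ℕ, (1 / 2 : ℝ) ^ c * (∑' σ : BStr, iweight I σ).toReal ≤ 1 / 4 := by
    have h1 : Filter.Tendsto
        (fun c : ℕ => (1 / 2 : ℝ) ^ c * (∑' σ : BStr, iweight I σ).toReal)
        Filter.atTop (nhds (0 * (∑' σ : BStr, iweight I σ).toReal)) :=
      (tendsto_pow_atTop_nhds_zero_of_lt_one (by norm_num) (by norm_num)).mul_const _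
    rw [zero_mul] at h1
    obtain ⟨c, hc⟩ := (h1.eventually (gt_mem_nhds (by norm_num : (0 : ℝ) < 1 / 4))).exists
    exact ⟨c, hc.le⟩
  refine ⟨c, fun σ => if h : (I σ).Dom then (I σ).get h + c else 0, ?_, ?_⟩
  · rintro σ m ⟨h, rfl⟩
    simp [h]
  · intro T hT
    have h1 : ∀ τ ∈ T, (1 / 2 : ℝ) ^ (if h : (I τ).Dom then (I τ).get h + c else 0) =
        (1 / 2) ^ c * (iweight I τ).toReal := by
      intro τ hτ
      rw [dif_pos (hT τ hτ), toReal_iweight (hT τ hτ), pow_add, mul_comm]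
    rw [Finset.sum_congr rfl h1, ← Finset.mul_sum]
    refine le_trans (mul_le_mul_of_nonneg_left ?_ (by positivity)) hc
    rw [← ENNReal.toReal_sum fun τ _ =>
      ne_top_of_le_ne_top hsum.ne (ENNReal.le_tsum τ)]
    exact ENNReal.toReal_mono hsum.ne (ENNReal.sum_le_tsum T)

theorem stmt0 (U : BStr →. BStr) (hU : UniversalPFM U)
    (I : BStr →. ℕ) (hI : Partrec I) (hsum : (∑' σ : BStr, iweight I σ) < ⊤)
    (X : ℕ → Bool) (hX : ∀ n, (I (stake X n)).Dom) :
    ∃ Y : ℕ → Bool, MLRandom U Y ∧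
      ComputableWithUse X Y
        (fun n => sInf {m : ℕ | ∃ i, n ≤ i ∧ m ∈ I (stake X i)}) := by
  obtain ⟨c, I', hI', hsum'⟩ := exists_shift hsum
  obtain ⟨live, J, E, V, hprim, hdata, hE, hV⟩ := exists_allocData hU.1 hI hI' hsum'
  have hXE : ∀ n, 0 < n → ∃ s₀, ∀ s, s₀ ≤ s → stake X n ∈ E s := by
    intro n hn
    refine hE _ (List.ne_nil_of_length_pos (by rwa [length_stake])) fun i _ hil => ?_
    rw [length_stake] at hil
    rw [take_stake X hil]
    exact hX i
  obtain ⟨Y, hYV, hYX⟩ := hdata.exists_stream hXE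
  have hrand : MLRandom U Y := by
    refine ⟨2, fun n => ?_⟩
    obtain ⟨ρ, hρ, hlen⟩ := hU.exists_description (stake Y n)
    by_contra hlt
    obtain ⟨s, hs⟩ := hV ρ _ hρ (by rw [length_stake]; omega)
    exact hYV s n hs
  refine ⟨fun k => Y (c + k), hU.mlRandom_shift hrand c,
    decoder (fun s => (allocState live J E s).2) (stake Y c),
    partrec_decoder (Primrec.snd.comp hprim) _, fun n => ?_⟩
  have hn : {m : ℕ | ∃ i, n ≤ i ∧ m ∈ I (stake X i)}.Nonempty :=
    ⟨_, n, le_rfl, Part.get_mem (hX n)⟩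
  obtain ⟨i, hni, hi⟩ := Nat.sInf_mem hn
  dsimp only
  generalize sInf {m : ℕ | ∃ i, n ≤ i ∧ m ∈ I (stake X i)} = m at hi
  obtain ⟨s, e, he, he1, he2⟩ : ∃ s, ∃ e ∈ (allocState live J E s).2,
      e.1 <+: stake Y c ++ stake (fun k => Y (c + k)) m ∧ stake X n <+: e.2 := by
    rcases Nat.eq_zero_or_pos n with rfl | hpos
    · exact ⟨0, ([], []), by simp [allocState], List.nil_prefix, by simp [stake]⟩
    · obtain ⟨s, e, he, he1, he2⟩ := hYX i (by omega)
      rw [hI' _ m hi, add_comm, stake_add] at he1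
      exact ⟨s, e, he, he1, (stake_prefix X hni).trans he2⟩
  have := mem_decoder (L := fun s => (allocState live J E s).2) (s := s)
    (fun s t e he e' he' h h' => hdata.log_comparable he he' h h') he he1 he2
  rwa [length_stake] at this
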